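/- arXiv:2103.15249 — 3 statements merged into one kernel-verified Lean document; each statement's English description precedes it below -/
import Mathlib

section
/- Let Z be an n × d random matrix with independent standard normal entries, with d ≥ 2n. Then E[−log det(Z Zᵀ / d)] ≤ 4n/d + n²/d. -/
open MeasureTheory ProbabilityTheory

open scoped Matrix MatrixOrder ENNReal

lemma Matrix.lintegral_comp_mulVec {ι : Type*} [Fintype ι] [DecidableEq ι]
    {A : Matrix ι ι ℝ} (hA : A.det ≠ 0) {f : (ι → ℝ) → ℝ≥0∞} (hf : Measurable f) :
    ∫⁻ w, f (A *ᵥ w) = ENNReal.ofReal |A.det⁻¹| * ∫⁻ w, f w := by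
  have h := Real.map_matrix_volume_pi_eq_smul_volume_pi hA
  have hm : Measurable (Matrix.toLin' A) := (LinearMap.continuous_of_finiteDimensional _).measurable
  rw [← smul_eq_mul, ← lintegral_smul_measure, ← h, lintegral_map hf hm]
  simp [Matrix.toLin'_apply]

lemma lintegral_exp_neg_mul_dotProduct_self {ι : Type*} [Fintype ι] {b : ℝ} (hb : 0 < b) :
    ∫⁻ w : ι → ℝ, ENNReal.ofReal (Real.exp (-b * (w ⬝ᵥ w))) =
      ENNReal.ofReal (√(Real.pi / b) ^ Fintype.card ι) := by
  have h (w : ι → ℝ) : Real.exp (-b * (w ⬝ᵥ w)) = ∏ i, Real.exp (-b * w i ^ 2) := by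
    rw [← Real.exp_sum, dotProduct, Finset.mul_sum]
    simp only [pow_two]
  simp_rw [h]
  rw [← ofReal_integral_eq_lintegral_ofReal]
  · rw [integral_fintype_prod_volume_eq_pow (fun x : ℝ ↦ Real.exp (-b * x ^ 2)),
      integral_gaussian]
  · exact Integrable.fintype_prod (f := fun _ x ↦ Real.exp (-b * x ^ 2))
      fun _ ↦ integrable_exp_neg_mul_sq hb
  · exact Filter.Eventually.of_forall fun w ↦ by positivity

lemma Matrix.PosDef.lintegral_exp_neg_half_quadratic {ι : Type*} [Fintype ι] [DecidableEq ι]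
    {M : Matrix ι ι ℝ} (hM : M.PosDef) :
    ∫⁻ w : ι → ℝ, ENNReal.ofReal (Real.exp (-(1 / 2) * (w ⬝ᵥ M *ᵥ w))) =
      ENNReal.ofReal ((√M.det)⁻¹ * √(2 * Real.pi) ^ Fintype.card ι) := by
  obtain ⟨B, hB⟩ := CStarAlgebra.nonneg_iff_eq_star_mul_self.mp hM.posSemidef.nonneg
  have hdet : M.det = B.det ^ 2 := by
    rw [hB, Matrix.det_mul, Matrix.star_eq_conjTranspose, Matrix.det_conjTranspose, star_trivial,
      pow_two]
  have hB0 : B.det ≠ 0 := fun h ↦ hM.det_pos.ne' (by simp [hdet, h])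
  have h (w : ι → ℝ) : w ⬝ᵥ M *ᵥ w = (B *ᵥ w) ⬝ᵥ (B *ᵥ w) := by
    rw [hB, Matrix.star_eq_conjTranspose, Matrix.conjTranspose_eq_transpose_of_trivial,
      ← Matrix.mulVec_mulVec, Matrix.dotProduct_mulVec, Matrix.vecMul_transpose]
  simp_rw [h]
  rw [Matrix.lintegral_comp_mulVec hB0
      (f := fun v ↦ ENNReal.ofReal (Real.exp (-(1 / 2) * (v ⬝ᵥ v))))
      (by simp only [dotProduct]; fun_prop),
    lintegral_exp_neg_mul_dotProduct_self (by norm_num), ← ENNReal.ofReal_mul (abs_nonneg _),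
    hdet, Real.sqrt_sq_eq_abs, abs_inv]
  congr 5
  ring

lemma Matrix.PosSemidef.le_lintegral_exp_neg_half_quadratic {ι : Type*} [Fintype ι]
    [DecidableEq ι] {M : Matrix ι ι ℝ} (hM : M.PosSemidef) :
    (ENNReal.ofReal √M.det)⁻¹ * ENNReal.ofReal (√(2 * Real.pi) ^ Fintype.card ι) ≤
      ∫⁻ w : ι → ℝ, ENNReal.ofReal (Real.exp (-(1 / 2) * (w ⬝ᵥ M *ᵥ w))) := by
  have hcont : Continuous fun ε : ℝ ↦
      (ENNReal.ofReal √(M + ε • (1 : Matrix ι ι ℝ)).det)⁻¹ :=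
    (ENNReal.continuous_ofReal.comp (by fun_prop)).inv
  have hlim : Filter.Tendsto (fun ε : ℝ ↦
      (ENNReal.ofReal √(M + ε • (1 : Matrix ι ι ℝ)).det)⁻¹ *
        ENNReal.ofReal (√(2 * Real.pi) ^ Fintype.card ι)) (nhdsWithin 0 (Set.Ioi 0))
      (nhds ((ENNReal.ofReal √M.det)⁻¹ *
        ENNReal.ofReal (√(2 * Real.pi) ^ Fintype.card ι))) := by
    refine ENNReal.Tendsto.mul_const ?_ (Or.inr ENNReal.ofReal_ne_top)
    simpa using (hcont.tendsto 0).mono_left nhdsWithin_le_nhds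
  refine le_of_tendsto hlim (Filter.eventually_of_mem self_mem_nhdsWithin fun ε (hε : 0 < ε) ↦ ?_)
  have hpd : (M + ε • (1 : Matrix ι ι ℝ)).PosDef :=
    Matrix.PosDef.posSemidef_add hM (Matrix.PosDef.one.smul hε)
  rw [← ENNReal.ofReal_inv_of_pos (Real.sqrt_pos.2 hpd.det_pos), ← ENNReal.ofReal_mul
    (by positivity), ← hpd.lintegral_exp_neg_half_quadratic]
  refine lintegral_mono fun w ↦ ENNReal.ofReal_le_ofReal (Real.exp_le_exp.2 ?_)
  have hw : 0 ≤ w ⬝ᵥ w := Finset.sum_nonneg fun i _ ↦ mul_self_nonneg (w i)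
  rw [Matrix.add_mulVec, dotProduct_add, Matrix.smul_mulVec, Matrix.one_mulVec, dotProduct_smul,
    smul_eq_mul]
  nlinarith

lemma map_swap_pi_pi {ι κ X : Type*} [Fintype ι] [Fintype κ] [MeasurableSpace X]
    (μ : Measure X) [IsProbabilityMeasure μ] :
    (Measure.pi fun _ : ι ↦ Measure.pi fun _ : κ ↦ μ).map (fun Z k i ↦ Z i k) =
      Measure.pi fun _ : κ ↦ Measure.pi fun _ : ι ↦ μ := by
  have h1 := Measure.infinitePi_map_curry (ι := ι) (κ := κ) fun _ _ ↦ μ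
  have h2 := Measure.infinitePi_map_curry (ι := κ) (κ := ι) fun _ _ ↦ μ
  simp only [Measure.infinitePi_eq_pi] at h1 h2
  have h3 := (measurePreserving_piCongrLeft (fun _ : κ × ι ↦ μ) (Equiv.prodComm ι κ)).map_eq
  rw [← h1, ← h2, ← h3, Measure.map_map (by fun_prop) (by fun_prop),
    Measure.map_map (by fun_prop) (by fun_prop)]
  congr 1

lemma map_dotProduct_pi_gaussianReal {ι : Type*} [Fintype ι] (w : ι → ℝ) :
    (Measure.pi fun _ : ι ↦ gaussianReal 0 1).map (fun x ↦ w ⬝ᵥ x) =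
      gaussianReal 0 (w ⬝ᵥ w).toNNReal := by
  have hw : 0 ≤ w ⬝ᵥ w := Finset.sum_nonneg fun i _ ↦ mul_self_nonneg (w i)
  refine Measure.ext_of_charFun ?_
  have hind : iIndepFun (fun i (x : ι → ℝ) ↦ w i * x i)
      (Measure.pi fun _ : ι ↦ gaussianReal 0 1) :=
    iIndepFun_pi (X := fun i x ↦ w i * x) fun i ↦ by fun_prop
  have hmap (i : ι) : (Measure.pi fun _ : ι ↦ gaussianReal 0 1).map (fun x ↦ w i * x i) =
      gaussianReal 0 (.mk (w i ^ 2) (sq_nonneg _) * 1) := by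
    have := gaussianReal_map_const_mul (μ := 0) (v := 1) (w i)
    rw [mul_zero] at this
    have heval := (measurePreserving_eval (fun _ : ι ↦ gaussianReal 0 1) i).map_eq
    rw [← this]
    conv_rhs => rw [← heval]
    rw [Measure.map_map (by fun_prop) (by fun_prop)]
    rfl
  rw [show (fun x : ι → ℝ ↦ w ⬝ᵥ x) = fun x ↦ ∑ i, w i * x i from rfl,
    hind.charFun_map_fun_sum_eq_prod fun i ↦ Measurable.aemeasurable (by fun_prop)]
  ext t
  simp only [hmap, Finset.prod_apply, charFun_gaussianReal, ← Complex.exp_sum]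
  rw [Real.coe_toNNReal _ hw]
  simp only [NNReal.coe_mk, mul_one]
  simp [dotProduct, Finset.sum_neg_distrib, ← Finset.sum_div, ← Finset.sum_mul, pow_two]

lemma lintegral_exp_neg_half_sq_gaussianReal (v : NNReal) :
    ∫⁻ x, ENNReal.ofReal (Real.exp (-(1 / 2) * x ^ 2)) ∂(gaussianReal 0 v) =
      ENNReal.ofReal (√(1 + v))⁻¹ := by
  rcases eq_or_ne v 0 with rfl | hv
  · simp
  have hv' : (0 : ℝ) < v := by positivity
  rw [← ofReal_integral_eq_lintegral_ofReal]
  · rw [integral_gaussianReal_eq_integral_smul hv]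
    simp only [gaussianPDFReal, smul_eq_mul, sub_zero, mul_assoc, ← Real.exp_add]
    rw [integral_const_mul]
    have (x : ℝ) : -x ^ 2 / (2 * v) + -(1 / 2) * x ^ 2 = -((1 + v) / (2 * v)) * x ^ 2 := by
      field_simp; ring
    simp_rw [this]
    rw [integral_gaussian, ← Real.sqrt_inv, ← Real.sqrt_inv, ← Real.sqrt_mul (by positivity)]
    congr 2
    field_simp
  · refine Integrable.of_bound (C := 1) (by fun_prop) (Filter.Eventually.of_forall fun x ↦ ?_)
    rw [Real.norm_of_nonneg (by positivity), Real.exp_le_one_iff]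
    nlinarith [sq_nonneg x]
  · exact Filter.Eventually.of_forall fun w ↦ by positivity

lemma lintegral_exp_neg_half_gram {ι κ : Type*} [Fintype ι] [Fintype κ] (w : ι → ℝ) :
    ∫⁻ Z : ι → κ → ℝ, ENNReal.ofReal
        (Real.exp (-(1 / 2) * (w ⬝ᵥ (Matrix.of Z * (Matrix.of Z)ᵀ) *ᵥ w)))
      ∂(Measure.pi fun _ ↦ Measure.pi fun _ ↦ gaussianReal 0 1) =
      ENNReal.ofReal ((√(1 + w ⬝ᵥ w))⁻¹ ^ Fintype.card κ) := by
  have hw : 0 ≤ w ⬝ᵥ w := Finset.sum_nonneg fun i _ ↦ mul_self_nonneg (w i)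
  have h (Z : ι → κ → ℝ) : ENNReal.ofReal
      (Real.exp (-(1 / 2) * (w ⬝ᵥ (Matrix.of Z * (Matrix.of Z)ᵀ) *ᵥ w))) =
        ∏ k, ENNReal.ofReal (Real.exp (-(1 / 2) * (w ⬝ᵥ fun i ↦ Z i k) ^ 2)) := by
    rw [← ENNReal.ofReal_prod_of_nonneg fun _ _ ↦ by positivity, ← Real.exp_sum, ← Finset.mul_sum,
      ← Matrix.mulVec_mulVec, Matrix.dotProduct_mulVec, Matrix.mulVec_transpose]
    simp only [dotProduct, Matrix.vecMul, pow_two, Matrix.of_apply]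
  have hm : Measurable fun x : ι → ℝ ↦
      ENNReal.ofReal (Real.exp (-(1 / 2) * (w ⬝ᵥ x) ^ 2)) := by
    simp only [dotProduct]; fun_prop
  simp_rw [h]
  rw [← lintegral_map (μ := Measure.pi fun _ : ι ↦ Measure.pi fun _ : κ ↦ gaussianReal 0 1)
      (f := fun Y : κ → ι → ℝ ↦
        ∏ k, ENNReal.ofReal (Real.exp (-(1 / 2) * (w ⬝ᵥ Y k) ^ 2)))
      (g := fun Z k i ↦ Z i k)
      (Finset.measurable_fun_prod _ fun k _ ↦ hm.comp (measurable_pi_apply k))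
      (by fun_prop), map_swap_pi_pi,
    lintegral_prod_eq_prod_lintegral_of_indepFun Finset.univ
      (fun k (Y : κ → ι → ℝ) ↦ ENNReal.ofReal (Real.exp (-(1 / 2) * (w ⬝ᵥ Y k) ^ 2)))
      (iIndepFun_pi fun k ↦ hm.aemeasurable) fun k ↦ hm.comp (measurable_pi_apply k)]
  have hk (k : κ) : ∫⁻ Y : κ → ι → ℝ, ENNReal.ofReal (Real.exp (-(1 / 2) * (w ⬝ᵥ Y k) ^ 2))
      ∂(Measure.pi fun _ ↦ Measure.pi fun _ ↦ gaussianReal 0 1) =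
      ENNReal.ofReal (√(1 + w ⬝ᵥ w))⁻¹ := by
    rw [(measurePreserving_eval (fun _ : κ ↦ Measure.pi fun _ : ι ↦ gaussianReal 0 1)
      k).lintegral_comp hm, ← lintegral_map (g := fun x ↦ w ⬝ᵥ x)
      (f := fun t ↦ ENNReal.ofReal (Real.exp (-(1 / 2) * t ^ 2))) (by fun_prop)
      (by simp only [dotProduct]; fun_prop), map_dotProduct_pi_gaussianReal,
      lintegral_exp_neg_half_sq_gaussianReal, Real.coe_toNNReal _ hw]
  simp_rw [hk]
  rw [Finset.prod_const, Finset.card_univ, ENNReal.ofReal_pow (by positivity)]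

lemma lintegral_rpow_mul_exp_neg_mul_Ioi {a r : ℝ} (ha : 0 < a) (hr : 0 < r) :
    ∫⁻ t in Set.Ioi 0, ENNReal.ofReal (t ^ (a - 1) * Real.exp (-(r * t))) =
      ENNReal.ofReal ((1 / r) ^ a * Real.Gamma a) := by
  have h := Real.integral_rpow_mul_exp_neg_mul_Ioi ha hr
  have hpos : 0 < (1 / r) ^ a * Real.Gamma a := by positivity
  rw [← h, ofReal_integral_eq_lintegral_ofReal]
  · exact .of_integral_ne_zero (h ▸ hpos.ne')
  · filter_upwards [ae_restrict_mem measurableSet_Ioi] with t (ht : 0 < t)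
    positivity

lemma lintegral_inv_sqrt_one_add_dotProduct_self_pow {ι : Type*} [Fintype ι] {d : ℕ}
    (hd : Fintype.card ι < d) :
    ∫⁻ w : ι → ℝ, ENNReal.ofReal ((√(1 + w ⬝ᵥ w))⁻¹ ^ d) =
      ENNReal.ofReal (√Real.pi ^ Fintype.card ι *
        (Real.Gamma (((d : ℝ) - Fintype.card ι) / 2) / Real.Gamma ((d : ℝ) / 2))) := by
  set n := Fintype.card ι with hn
  have hd0 : (0 : ℝ) < d := by exact_mod_cast (Nat.zero_le _).trans_lt hd
  have hdn : (0 : ℝ) < (d : ℝ) - n := by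
    have : (n : ℝ) < d := by exact_mod_cast hd
    linarith
  have hΓ : 0 < Real.Gamma ((d : ℝ) / 2) := Real.Gamma_pos_of_pos (by positivity)
  have hw (w : ι → ℝ) : 0 ≤ w ⬝ᵥ w := Finset.sum_nonneg fun i _ ↦ mul_self_nonneg (w i)
  have hGamma (w : ι → ℝ) : ENNReal.ofReal ((√(1 + w ⬝ᵥ w))⁻¹ ^ d) =
      ENNReal.ofReal (Real.Gamma ((d : ℝ) / 2))⁻¹ * ∫⁻ t in Set.Ioi (0 : ℝ),
        ENNReal.ofReal (t ^ ((d : ℝ) / 2 - 1) * Real.exp (-((1 + w ⬝ᵥ w) * t))) := by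
    have h1 : 0 < 1 + w ⬝ᵥ w := by linarith [hw w]
    rw [lintegral_rpow_mul_exp_neg_mul_Ioi (by positivity) h1,
      ← ENNReal.ofReal_mul (by positivity), mul_left_comm, inv_mul_cancel₀ hΓ.ne', mul_one,
      Real.sqrt_eq_rpow, ← Real.inv_rpow h1.le, ← Real.rpow_mul_natCast (by positivity)]
    congr 2
    · ring
    · ring
  have hinner (t : ℝ) (ht : 0 < t) : ∫⁻ w : ι → ℝ,
      ENNReal.ofReal (t ^ ((d : ℝ) / 2 - 1) * Real.exp (-((1 + w ⬝ᵥ w) * t))) =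
      ENNReal.ofReal (√Real.pi ^ n) *
        ENNReal.ofReal (t ^ (((d : ℝ) - n) / 2 - 1) * Real.exp (-(1 * t))) := by
    have h (w : ι → ℝ) : ENNReal.ofReal
        (t ^ ((d : ℝ) / 2 - 1) * Real.exp (-((1 + w ⬝ᵥ w) * t))) =
        ENNReal.ofReal (t ^ ((d : ℝ) / 2 - 1) * Real.exp (-(1 * t))) *
          ENNReal.ofReal (Real.exp (-t * (w ⬝ᵥ w))) := by
      rw [← ENNReal.ofReal_mul (by positivity), mul_assoc, ← Real.exp_add]
      ring_nf
    simp_rw [h]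
    rw [lintegral_const_mul _ (by simp only [dotProduct]; fun_prop),
      lintegral_exp_neg_mul_dotProduct_self ht, ← ENNReal.ofReal_mul (by positivity),
      ← ENNReal.ofReal_mul (by positivity), ← hn]
    congr 1
    have hpow : t ^ ((d : ℝ) / 2 - 1) = t ^ (((d : ℝ) - n) / 2 - 1) * √t ^ n := by
      rw [Real.sqrt_eq_rpow, ← Real.rpow_mul_natCast ht.le, ← Real.rpow_add ht]
      ring_nf
    rw [Real.sqrt_div Real.pi_pos.le, div_pow, hpow]
    have : √t ≠ 0 := (Real.sqrt_pos.2 ht).ne'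
    field_simp
  simp_rw [hGamma]
  rw [lintegral_const_mul' _ _ ENNReal.ofReal_ne_top, lintegral_lintegral_swap
      (by simp only [dotProduct, Function.uncurry_def]; fun_prop),
    setLIntegral_congr_fun measurableSet_Ioi hinner,
    lintegral_const_mul' _ _ ENNReal.ofReal_ne_top,
    lintegral_rpow_mul_exp_neg_mul_Ioi (by positivity) one_pos,
    ← ENNReal.ofReal_mul (by positivity), ← ENNReal.ofReal_mul (by positivity)]
  congr 1
  simp
  field_simp

lemma lintegral_inv_sqrt_det_gram_le {ι κ : Type*} [Fintype ι] [DecidableEq ι] [Fintype κ]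
    (h : Fintype.card ι < Fintype.card κ) :
    ∫⁻ Z : ι → κ → ℝ, (ENNReal.ofReal √(Matrix.of Z * (Matrix.of Z)ᵀ).det)⁻¹
      ∂(Measure.pi fun _ ↦ Measure.pi fun _ ↦ gaussianReal 0 1) ≤
      ENNReal.ofReal ((√2)⁻¹ ^ Fintype.card ι *
        (Real.Gamma (((Fintype.card κ : ℝ) - Fintype.card ι) / 2) /
          Real.Gamma ((Fintype.card κ : ℝ) / 2))) := by
  have hpi : 0 < √(2 * Real.pi) ^ Fintype.card ι := by positivity
  refine (ENNReal.mul_le_mul_iff_left (c := ENNReal.ofReal (√(2 * Real.pi) ^ Fintype.card ι))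
    (ENNReal.ofReal_pos.2 hpi).ne' ENNReal.ofReal_ne_top).1 ?_
  rw [← lintegral_mul_const' _ _ ENNReal.ofReal_ne_top, ← ENNReal.ofReal_mul' hpi.le]
  calc
    _ ≤ ∫⁻ Z : ι → κ → ℝ, (∫⁻ w : ι → ℝ, ENNReal.ofReal
          (Real.exp (-(1 / 2) * (w ⬝ᵥ (Matrix.of Z * (Matrix.of Z)ᵀ) *ᵥ w))))
        ∂(Measure.pi fun _ ↦ Measure.pi fun _ ↦ gaussianReal 0 1) := by
      refine lintegral_mono fun Z ↦ Matrix.PosSemidef.le_lintegral_exp_neg_half_quadratic ?_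
      simpa using Matrix.posSemidef_self_mul_conjTranspose (Matrix.of Z)
    _ = _ := by
      rw [lintegral_lintegral_swap]
      · simp_rw [lintegral_exp_neg_half_gram]
        rw [lintegral_inv_sqrt_one_add_dotProduct_self_pow h, mul_right_comm, ← mul_pow,
          Real.sqrt_mul zero_le_two, inv_mul_cancel_left₀ (by positivity)]
      · simp only [dotProduct, Matrix.mulVec, Matrix.mul_apply, Function.uncurry_def,
          Matrix.transpose_apply, Matrix.of_apply]
        fun_prop

lemma Real.log_Gamma_sub_half_le {y : ℝ} (hy : 1 < y) :
    2 * (Real.log (Real.Gamma (y - 1 / 2)) - Real.log (Real.Gamma y)) ≤ -Real.log (y - 1) := by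
  have hy' : 0 < y - 1 := by linarith
  have h := Real.convexOn_log_Gamma.2 (Set.mem_Ioi.2 hy') (Set.mem_Ioi.2 (by linarith : 0 < y))
    (by norm_num : (0 : ℝ) ≤ 1 / 2) (by norm_num : (0 : ℝ) ≤ 1 / 2) (by norm_num)
  have hG : Real.Gamma y = (y - 1) * Real.Gamma (y - 1) := by
    simpa using Real.Gamma_add_one hy'.ne'
  have hlog : Real.log (Real.Gamma y) = Real.log (y - 1) + Real.log (Real.Gamma (y - 1)) := by
    rw [hG, Real.log_mul hy'.ne' (Real.Gamma_pos_of_pos hy').ne']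
  have he : (1 / 2 : ℝ) • (y - 1) + (1 / 2 : ℝ) • y = y - 1 / 2 := by
    simp only [smul_eq_mul]; ring
  rw [he] at h
  simp only [Function.comp_apply, smul_eq_mul] at h
  linarith

lemma Real.neg_log_one_sub_le {y : ℝ} (h0 : 0 ≤ y) (h1 : y ≤ 3 / 4) :
    -Real.log (1 - y) ≤ 2 * y := by
  have hexp : Real.exp (-(3 / 2)) ≤ 1 / 4 := by
    have h4 : (4 : ℝ) ≤ Real.exp (3 / 2) := by
      refine le_trans ?_ (Real.sum_le_exp_of_nonneg (by norm_num) 5)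
      norm_num [Finset.sum_range_succ, Nat.factorial]
    rw [Real.exp_neg, one_div]
    gcongr
  have hc := convexOn_exp.2 (Set.mem_univ (0 : ℝ)) (Set.mem_univ (-(3 / 2) : ℝ))
    (by linarith : (0 : ℝ) ≤ 1 - 4 / 3 * y) (by positivity : (0 : ℝ) ≤ 4 / 3 * y) (by ring)
  simp only [smul_eq_mul, mul_zero, zero_add, Real.exp_zero, mul_one] at hc
  have hle : Real.exp (-(2 * y)) ≤ 1 - y := by
    rw [show -(2 * y) = 4 / 3 * y * -(3 / 2) by ring]
    nlinarith
  have := (Real.le_log_iff_exp_le (by linarith)).2 hle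
  linarith

lemma log_Gamma_ratio_le_of_four_mul_le {d : ℕ} :
    ∀ {n : ℕ}, 4 * (n + 1) ≤ 3 * d →
      n * (Real.log d - Real.log 2) +
        2 * (Real.log (Real.Gamma (((d : ℝ) - n) / 2)) - Real.log (Real.Gamma ((d : ℝ) / 2))) ≤
      (n ^ 2 + 3 * n) / d
  | 0, _ => by simp
  | n + 1, hn => by
    have ih := log_Gamma_ratio_le_of_four_mul_le (d := d) (n := n) (by omega)
    have hn' : (4 : ℝ) * (n + 2) ≤ 3 * d := by
      have : 4 * (n + 2) ≤ 3 * d := by omega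
      exact_mod_cast this
    have hn0 : (0 : ℝ) ≤ n := by positivity
    have hd : (0 : ℝ) < d := by linarith
    have hstep := Real.log_Gamma_sub_half_le (y := ((d : ℝ) - n) / 2) (by linarith)
    have hlog := Real.neg_log_one_sub_le (y := ((n : ℝ) + 2) / d) (by positivity)
      (by rw [div_le_div_iff₀ hd (by norm_num)]; linarith)
    have hfac : ((d : ℝ) - n) / 2 - 1 = d * (1 - (n + 2) / d) / 2 := by field_simp; ring
    have hpos : 0 < 1 - ((n : ℝ) + 2) / d := by
      rw [sub_pos, div_lt_one hd]; linarith
    rw [hfac, Real.log_div (by positivity) two_ne_zero, Real.log_mul hd.ne' hpos.ne'] at hstep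
    have harg : ((d : ℝ) - (n + 1 : ℕ)) / 2 = ((d : ℝ) - n) / 2 - 1 / 2 := by push_cast; ring
    have hrhs : (((n + 1 : ℕ) : ℝ) ^ 2 + 3 * (n + 1 : ℕ)) / d =
        (n ^ 2 + 3 * n) / d + 2 * ((n + 2) / d) := by push_cast; ring
    rw [harg, hrhs]
    push_cast
    linarith

lemma log_Gamma_ratio_le {n d : ℕ} (hn : 0 < n) (hd : 2 * n ≤ d) :
    n * (Real.log d - Real.log 2) +
        2 * (Real.log (Real.Gamma (((d : ℝ) - n) / 2)) - Real.log (Real.Gamma ((d : ℝ) / 2))) ≤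
      4 * n / d + n ^ 2 / d := by
  by_cases h : 4 * (n + 1) ≤ 3 * d
  · refine (log_Gamma_ratio_le_of_four_mul_le h).trans ?_
    rw [← add_div]
    gcongr ?_ / _
    have : (0 : ℝ) ≤ n := by positivity
    linarith
  · obtain ⟨rfl, rfl⟩ : n = 1 ∧ d = 2 := by omega
    have hpi : Real.log (Real.Gamma (1 / 2)) = Real.log Real.pi / 2 := by
      rw [Real.Gamma_one_half_eq, Real.log_sqrt Real.pi_pos.le]
    norm_num [hpi]
    linarith [Real.log_le_sub_one_of_pos Real.pi_pos, Real.pi_lt_d2]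

lemma integral_neg_log_mul_le_of_lintegral_inv_sqrt_le {Ω : Type*} {mΩ : MeasurableSpace Ω}
    {P : Measure Ω} [IsProbabilityMeasure P] {D : Ω → ℝ} (hDm : Measurable D) {c C : ℝ}
    (hc : 0 < c) (hC : 0 < C) (hle : ∫⁻ ω, (ENNReal.ofReal √(D ω))⁻¹ ∂P ≤ ENNReal.ofReal C)
    (hL : Integrable (fun ω ↦ -Real.log (c * D ω)) P) :
    ∫ ω, -Real.log (c * D ω) ∂P ≤ 2 * Real.log C - Real.log c := by
  have hpos : ∀ᵐ ω ∂P, 0 < D ω := by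
    filter_upwards [ae_lt_top (by fun_prop) (hle.trans_lt ENNReal.ofReal_lt_top).ne] with ω hω
    simpa [ENNReal.inv_lt_top] using hω
  have hle' : ∫⁻ ω, ENNReal.ofReal (√(D ω))⁻¹ ∂P ≤ ENNReal.ofReal C := by
    refine (lintegral_congr_ae ?_).trans_le hle
    filter_upwards [hpos] with ω hω
    exact ENNReal.ofReal_inv_of_pos (Real.sqrt_pos.2 hω)
  have hnn : 0 ≤ᵐ[P] fun ω ↦ (√(D ω))⁻¹ := .of_forall fun ω ↦ by positivity
  have hm : AEStronglyMeasurable (fun ω ↦ (√(D ω))⁻¹) P :=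
    (hDm.sqrt.inv).aestronglyMeasurable
  have hint : Integrable (fun ω ↦ (√(D ω))⁻¹) P :=
    ⟨hm, (hasFiniteIntegral_iff_ofReal hnn).2 (hle'.trans_lt ENNReal.ofReal_lt_top)⟩
  have hEle : ∫ ω, (√(D ω))⁻¹ ∂P ≤ C := by
    rw [integral_eq_lintegral_of_nonneg_ae hnn hm]
    exact ENNReal.toReal_le_of_le_ofReal hC.le hle'
  calc
    _ ≤ ∫ ω, (2 * C⁻¹ * (√(D ω))⁻¹ + (2 * Real.log C - 2 - Real.log c)) ∂P := by
      refine integral_mono_ae hL ((hint.const_mul _).add (integrable_const _)) ?_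
      filter_upwards [hpos] with ω hω
      have hs : 0 < (√(D ω))⁻¹ := by positivity
      have h1 := Real.log_le_sub_one_of_pos (mul_pos (inv_pos.2 hC) hs)
      rw [Real.log_mul (by positivity) hs.ne', Real.log_inv, Real.log_inv,
        Real.log_sqrt hω.le] at h1
      rw [Real.log_mul hc.ne' hω.ne']
      linarith
    _ = 2 * C⁻¹ * ∫ ω, (√(D ω))⁻¹ ∂P + (2 * Real.log C - 2 - Real.log c) := by
      rw [integral_add (hint.const_mul _) (integrable_const _), integral_const_mul]
      simp
    _ ≤ 2 * C⁻¹ * C + (2 * Real.log C - 2 - Real.log c) := by gcongr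
    _ = _ := by
      rw [mul_assoc, inv_mul_cancel₀ hC.ne']
      ring

/-- Let `Z` be an `n × d` random matrix with independent standard normal entries, with
`d ≥ 2n`.  Then `E[−log det(Z Zᵀ / d)] ≤ 4n/d + n²/d`. -/
theorem expected_neg_log_det_wishart_le (n d : ℕ) (hn : 0 < n) (hd : 2 * n ≤ d) :
    ∫ Z : Fin n → Fin d → ℝ,
        -Real.log
          (Matrix.det (Matrix.of fun i j : Fin n => (∑ k : Fin d, Z i k * Z j k) / d))
      ∂(Measure.pi fun _ : Fin n => Measure.pi fun _ : Fin d => gaussianReal 0 1)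
    ≤ 4 * n / d + n ^ 2 / d := by
  have hnd : (n : ℝ) < d := by
    have : n < d := by omega
    exact_mod_cast this
  have hd0 : (0 : ℝ) < d := (Nat.cast_nonneg n).trans_lt hnd
  have hscale (Z : Fin n → Fin d → ℝ) :
      Matrix.det (Matrix.of fun i j : Fin n => (∑ k : Fin d, Z i k * Z j k) / d) =
        (d : ℝ)⁻¹ ^ n * (Matrix.of Z * (Matrix.of Z)ᵀ).det := by
    have h : (Matrix.of fun i j : Fin n => (∑ k : Fin d, Z i k * Z j k) / d) =
        (d : ℝ)⁻¹ • (Matrix.of Z * (Matrix.of Z)ᵀ) := by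
      ext i j
      simp [Matrix.mul_apply, div_eq_inv_mul]
    rw [h, Matrix.det_smul, Fintype.card_fin]
  simp_rw [hscale]
  by_cases hL : Integrable (fun Z : Fin n → Fin d → ℝ ↦
      -Real.log ((d : ℝ)⁻¹ ^ n * (Matrix.of Z * (Matrix.of Z)ᵀ).det))
      (Measure.pi fun _ ↦ Measure.pi fun _ ↦ gaussianReal 0 1)
  swap
  · rw [integral_undef hL]
    positivity
  have hDm : Measurable fun Z : Fin n → Fin d → ℝ ↦ (Matrix.of Z * (Matrix.of Z)ᵀ).det := by
    have hZ : Continuous fun Z : Fin n → Fin d → ℝ ↦ Matrix.of Z := continuous_id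
    exact (hZ.matrix_mul hZ.matrix_transpose).matrix_det.measurable
  have hΓ1 : 0 < Real.Gamma (((d : ℝ) - n) / 2) := Real.Gamma_pos_of_pos (by linarith)
  have hΓ2 : 0 < Real.Gamma ((d : ℝ) / 2) := Real.Gamma_pos_of_pos (by linarith)
  have hle := lintegral_inv_sqrt_det_gram_le (ι := Fin n) (κ := Fin d) (by simp; omega)
  simp only [Fintype.card_fin] at hle
  refine (integral_neg_log_mul_le_of_lintegral_inv_sqrt_le hDm (by positivity) (by positivity)
    hle hL).trans ?_
  rw [Real.log_mul (by positivity) (by positivity), Real.log_pow, Real.log_inv,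
    Real.log_sqrt zero_le_two, Real.log_div hΓ1.ne' hΓ2.ne', Real.log_pow, Real.log_inv]
  linarith [log_Gamma_ratio_le hn hd]
end

section
/- Let x₁, x₂, x₃ be independent uniform random points on S^{d−1}, d ≥ 2. Then P(⟨x₁,x₂⟩ ≥ 0, ⟨x₂,x₃⟩ ≥ 0, ⟨x₃,x₁⟩ ≥ 0) − 1/8 lies between 1/(2π√(2π)√d) and 1/(4√π√d). -/
open MeasureTheory ProbabilityTheory Real

/-- The uniform probability measure on the unit sphere `S^{d−1} ⊂ ℝ^d`. -/
noncomputable def uniformSphere (d : ℕ) : Measure (Fin d → ℝ) :=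
  (Measure.pi fun _ : Fin d => gaussianReal 0 1).map
    fun z => (Real.sqrt (∑ i, z i ^ 2))⁻¹ • z

/-- The standard planar Gaussian measure of an angular sector is proportional to its opening. -/
lemma gaussianReal_prod_of_polar {S : Set (ℝ × ℝ)} (hS : MeasurableSet S) {T : Set ℝ}
    (hT : MeasurableSet T) (hTI : T ⊆ Set.Ioo (-π) π)
    (h : ∀ r > 0, ∀ θ ∈ Set.Ioo (-π) π, (r * cos θ, r * sin θ) ∈ S ↔ θ ∈ T) :
    ((gaussianReal 0 1).prod (gaussianReal 0 1)) S =
      (∫⁻ r in Set.Ioi (0 : ℝ), ENNReal.ofReal (r * ((2 * π)⁻¹ * rexp (-r ^ 2 / 2)))) *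
        volume T := by
  have hpdf (p : ℝ × ℝ) : gaussianPDF 0 1 p.1 * gaussianPDF 0 1 p.2 =
      ENNReal.ofReal ((2 * π)⁻¹ * rexp (-(p.1 ^ 2 + p.2 ^ 2) / 2)) := by
    rw [gaussianPDF, gaussianPDF, ← ENNReal.ofReal_mul (gaussianPDFReal_nonneg _ _ _)]
    congr 1
    simp only [gaussianPDFReal, NNReal.coe_one, mul_one, sub_zero]
    have h2 : (√(2 * π))⁻¹ * (√(2 * π))⁻¹ = (2 * π)⁻¹ := by
      rw [← mul_inv, mul_self_sqrt (by positivity)]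
    rw [← h2, neg_add, add_div, exp_add]
    ring
  rw [gaussianReal_of_var_ne_zero _ one_ne_zero,
    prod_withDensity (measurable_gaussianPDF _ _) (measurable_gaussianPDF _ _),
    withDensity_apply _ hS, ← Measure.volume_eq_prod, ← lintegral_indicator hS,
    ← lintegral_comp_polarCoord_symm]
  have hmeas : Measurable fun r : ℝ ↦
      ENNReal.ofReal (r * ((2 * π)⁻¹ * rexp (-r ^ 2 / 2))) := by fun_prop
  have key : ∀ p ∈ polarCoord.target,
      ENNReal.ofReal p.1 • S.indicator
        (fun z ↦ gaussianPDF 0 1 z.1 * gaussianPDF 0 1 z.2) (polarCoord.symm p) =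
      ENNReal.ofReal (p.1 * ((2 * π)⁻¹ * rexp (-p.1 ^ 2 / 2))) * T.indicator 1 p.2 := by
    rintro ⟨r, θ⟩ ⟨hr, hθ⟩
    simp only [Set.mem_Ioi] at hr
    rw [polarCoord_symm_apply]
    by_cases hm : θ ∈ T
    · rw [Set.indicator_of_mem ((h r hr θ hθ).2 hm), Set.indicator_of_mem hm, hpdf, smul_eq_mul,
        ← ENNReal.ofReal_mul hr.le, Pi.one_apply, mul_one]
      congr 5
      linear_combination -r ^ 2 * cos_sq_add_sin_sq θ
    · rw [Set.indicator_of_notMem (mt (h r hr θ hθ).1 hm), Set.indicator_of_notMem hm]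
      simp
  rw [setLIntegral_congr_fun polarCoord.open_target.measurableSet key, polarCoord_target,
    Measure.volume_eq_prod, ← Measure.prod_restrict,
    lintegral_prod_mul hmeas.aemeasurable (measurable_one.indicator hT).aemeasurable,
    lintegral_indicator_one hT, Measure.restrict_apply hT, Set.inter_eq_left.2 hTI]

lemma measurableSet_sector (ρ : ℝ) :
    MeasurableSet {p : ℝ × ℝ | 0 ≤ p.1 ∧ 0 ≤ ρ * p.1 + √(1 - ρ ^ 2) * p.2} :=
  (measurableSet_le measurable_const measurable_fst).inter
    (measurableSet_le measurable_const
      (by fun_prop : Measurable fun p : ℝ × ℝ ↦ ρ * p.1 + √(1 - ρ ^ 2) * p.2))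

lemma gaussianReal_prod_sector {ρ : ℝ} (h0 : 0 ≤ ρ) (h1 : ρ ≤ 1) :
    ((gaussianReal 0 1).prod (gaussianReal 0 1))
      {p | 0 ≤ p.1 ∧ 0 ≤ ρ * p.1 + √(1 - ρ ^ 2) * p.2} =
        ENNReal.ofReal (1 / 4 + arcsin ρ / (2 * π)) := by
  have hα0 : 0 ≤ arcsin ρ := arcsin_nonneg.2 h0
  have hα1 := arcsin_le_pi_div_two ρ
  have hπ := pi_pos
  have htot := gaussianReal_prod_of_polar MeasurableSet.univ measurableSet_Ioo
    (Set.Subset.refl (Set.Ioo (-π) π)) (by simp)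
  rw [measure_univ, Real.volume_Ioo] at htot
  rw [gaussianReal_prod_of_polar (T := Set.Icc (-arcsin ρ) (π / 2)) ?_ measurableSet_Icc ?_ ?_,
    Real.volume_Icc]
  · have hI : (∫⁻ r in Set.Ioi (0 : ℝ), ENNReal.ofReal (r * ((2 * π)⁻¹ * rexp (-r ^ 2 / 2)))) =
        ENNReal.ofReal (2 * π)⁻¹ := by
      rw [ENNReal.ofReal_inv_of_pos (by positivity)]
      refine ENNReal.eq_inv_of_mul_eq_one_left ?_
      convert htot.symm using 3
      ring
    rw [hI, ← ENNReal.ofReal_mul (by positivity)]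
    congr 1
    field_simp
    ring
  · exact measurableSet_sector ρ
  · intro θ hθ
    constructor <;> linarith [hθ.1, hθ.2]
  · intro r hr θ hθ
    have hs : ρ * (r * cos θ) + √(1 - ρ ^ 2) * (r * sin θ) = r * sin (θ + arcsin ρ) := by
      rw [sin_add, cos_arcsin, sin_arcsin (by linarith) h1]; ring
    simp only [Set.mem_ofPred_eq, hs, mul_nonneg_iff_of_pos_left hr, Set.mem_Icc]
    constructor
    · rintro ⟨hc, hsn⟩
      have h2 : θ ≤ π / 2 := by
        by_contra! hlt
        exact absurd hc (not_le.2 (cos_neg_of_pi_div_two_lt_of_lt hlt (by linarith [hθ.2])))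
      refine ⟨?_, h2⟩
      by_contra! hlt
      have h3 : -(π / 2) ≤ θ := by
        by_contra! hlt'
        refine absurd hc (not_le.2 ?_)
        rw [← cos_neg]
        exact cos_neg_of_pi_div_two_lt_of_lt (by linarith) (by linarith [hθ.1])
      exact absurd hsn (not_le.2 (sin_neg_of_neg_of_neg_pi_lt (by linarith) (by linarith)))
    · rintro ⟨ha, hb⟩
      exact ⟨cos_nonneg_of_mem_Icc ⟨by linarith, hb⟩,
        sin_nonneg_of_nonneg_of_le_pi (by linarith) (by linarith)⟩

lemma gaussianReal_Ici_zero : gaussianReal 0 1 (Set.Ici 0) = ENNReal.ofReal (1 / 2) := by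
  have h := gaussianReal_prod_sector zero_le_one le_rfl
  have hs : {p : ℝ × ℝ | 0 ≤ p.1 ∧ 0 ≤ 1 * p.1 + √(1 - 1 ^ 2) * p.2} =
      Set.Ici 0 ×ˢ Set.univ := by
    ext p; simp
  rw [hs, Measure.prod_prod, measure_univ, mul_one, arcsin_one] at h
  rw [h]
  congr 1
  field_simp
  norm_num

lemma integral_max_zero_gaussianReal : ∫ x, max x 0 ∂gaussianReal 0 1 = (√(2 * π))⁻¹ := by
  have h := integral_rpow_mul_exp_neg_mul_rpow (p := 2) (q := 1) (b := 1 / 2) (by norm_num)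
    (by norm_num) (by norm_num)
  rw [integral_gaussianReal_eq_integral_smul one_ne_zero]
  have hind : (fun x ↦ gaussianPDFReal 0 1 x • max x 0) = (Set.Ioi 0).indicator
      fun x ↦ (√(2 * π))⁻¹ * (x ^ (1 : ℝ) * rexp (-(1 / 2) * x ^ (2 : ℝ))) := by
    ext x
    by_cases hx : 0 < x
    · rw [Set.indicator_of_mem (Set.mem_Ioi.2 hx), max_eq_left hx.le]
      simp only [gaussianPDFReal, NNReal.coe_one, mul_one, sub_zero, smul_eq_mul, rpow_one,
        rpow_two]
      ring_nf
    · rw [Set.indicator_of_notMem (by simpa using hx), max_eq_right (not_lt.1 hx), smul_zero]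
  rw [hind, integral_indicator measurableSet_Ioi, integral_const_mul, h]
  norm_num

section StdGaussian

open scoped RealInnerProductSpace

variable {E : Type*} [NormedAddCommGroup E] [InnerProductSpace ℝ E] [FiniteDimensional ℝ E]
  [MeasurableSpace E] [BorelSpace E]

lemma stdGaussian_map_inner {u : E} (hu : ‖u‖ = 1) :
    (stdGaussian E).map (fun z ↦ ⟪u, z⟫) = gaussianReal 0 1 := by
  have h := IsGaussian.map_eq_gaussianReal (μ := stdGaussian E) (innerSL ℝ u)
  rw [integral_strongDual_stdGaussian, variance_dual_stdGaussian, innerSL_apply_norm, hu] at h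
  simpa using h

lemma stdGaussian_map_inner_prod {u w : E} (hu : ‖u‖ = 1) (hw : ‖w‖ = 1) (huw : ⟪u, w⟫ = 0) :
    (stdGaussian E).map (fun z ↦ (⟪u, z⟫, ⟪w, z⟫)) =
      (gaussianReal 0 1).prod (gaussianReal 0 1) := by
  have hf : (fun z ↦ (⟪u, z⟫, ⟪w, z⟫)) = ⇑((innerSL ℝ u).prod (innerSL ℝ w)) := by
    ext z <;> simp
  rw [hf]
  refine Measure.ext_of_charFunDual (funext fun L ↦ ?_)
  rw [charFunDual_prod, charFunDual_map, charFunDual_stdGaussian, ← stdGaussian_map_inner hu,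
    show (fun z ↦ ⟪u, z⟫) = ⇑(innerSL ℝ u) by ext z; simp, charFunDual_map, charFunDual_map,
    charFunDual_stdGaussian, charFunDual_stdGaussian, ← Complex.exp_add]
  set a := L (1, 0)
  set b := L (0, 1)
  have hL (x y : ℝ) : L (x, y) = x * a + y * b := by
    rw [show ((x, y) : ℝ × ℝ) = x • (1, 0) + y • (0, 1) by ext <;> simp, map_add, map_smul,
      map_smul, smul_eq_mul, smul_eq_mul]
  have h1 : L.comp ((innerSL ℝ u).prod (innerSL ℝ w)) = innerSL ℝ (a • u + b • w) := by
    ext z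
    simp [hL, mul_comm]
  have h2 : (L.comp (.inl ℝ ℝ ℝ)).comp (innerSL ℝ u) = innerSL ℝ (a • u) := by
    ext z
    simp [hL, mul_comm]
  have h3 : (L.comp (.inr ℝ ℝ ℝ)).comp (innerSL ℝ u) = innerSL ℝ (b • u) := by
    ext z
    simp [hL, mul_comm]
  have h4 : ‖a • u + b • w‖ ^ 2 = ‖a • u‖ ^ 2 + ‖b • u‖ ^ 2 := by
    rw [norm_add_sq_real, inner_smul_left, inner_smul_right, huw]
    simp [norm_smul, hu, hw]
  rw [h1, h2, h3, innerSL_apply_norm, innerSL_apply_norm, innerSL_apply_norm]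
  congr 1
  have h5 : ((‖a • u + b • w‖ ^ 2 : ℝ) : ℂ) = ((‖a • u‖ ^ 2 + ‖b • u‖ ^ 2 : ℝ) : ℂ) := by rw [h4]
  push_cast at h5
  rw [h5]
  ring

lemma stdGaussian_halfSpace {u : E} (hu : ‖u‖ = 1) :
    stdGaussian E {z | 0 ≤ ⟪u, z⟫} = ENNReal.ofReal (1 / 2) := by
  rw [← gaussianReal_Ici_zero, ← stdGaussian_map_inner hu,
    Measure.map_apply (by fun_prop) measurableSet_Ici]
  rfl

lemma stdGaussian_wedge {u v : E} (hu : ‖u‖ = 1) (hv : ‖v‖ = 1) (h : 0 ≤ ⟪u, v⟫) :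
    stdGaussian E {z | 0 ≤ ⟪u, z⟫ ∧ 0 ≤ ⟪v, z⟫} =
      ENNReal.ofReal (1 / 4 + arcsin ⟪u, v⟫ / (2 * π)) := by
  have hle : ⟪u, v⟫ ≤ 1 := by simpa [hu, hv] using real_inner_le_norm u v
  rcases hle.eq_or_lt with h1 | h1
  · obtain rfl : u = v := (inner_eq_one_iff_of_norm_eq_one hu hv).1 h1
    simp only [and_self]
    rw [stdGaussian_halfSpace hu, h1, arcsin_one]
    congr 1
    field_simp
    norm_num
  · set ρ := ⟪u, v⟫ with hρ
    have hpos : 0 < 1 - ρ ^ 2 := by nlinarith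
    set s := √(1 - ρ ^ 2) with hs
    have hs0 : 0 < s := sqrt_pos.2 hpos
    have hs2 : s ^ 2 = 1 - ρ ^ 2 := sq_sqrt hpos.le
    set w := s⁻¹ • (v - ρ • u) with hw
    have huw : ⟪u, w⟫ = 0 := by
      rw [hw, inner_smul_right, inner_sub_right, inner_smul_right, real_inner_self_eq_norm_sq, hu,
        ← hρ]
      simp
    have hsw : s • w = v - ρ • u := by rw [hw, smul_inv_smul₀ hs0.ne']
    have hw1 : ‖w‖ = 1 := by
      have h2 : ‖s • w‖ ^ 2 = s ^ 2 := by
        rw [hsw, norm_sub_sq_real, inner_smul_right, real_inner_comm, ← hρ, norm_smul, hu, hv, hs2,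
          mul_one, norm_eq_abs, sq_abs]
        ring
      rw [norm_smul, norm_eq_abs, abs_of_pos hs0, mul_pow] at h2
      have h3 : ‖w‖ ^ 2 = 1 := mul_left_cancel₀ (pow_ne_zero 2 hs0.ne') (h2.trans (mul_one _).symm)
      exact (pow_eq_one_iff_of_nonneg (norm_nonneg w) two_ne_zero).1 h3
    have hvz (z : E) : ⟪v, z⟫ = ρ * ⟪u, z⟫ + s * ⟪w, z⟫ := by
      rw [show v = ρ • u + s • w by rw [hsw]; abel, inner_add_left, inner_smul_left,
        inner_smul_left]
      simp
    rw [← gaussianReal_prod_sector h hle, ← stdGaussian_map_inner_prod hu hw1 huw,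
      Measure.map_apply (by fun_prop) (measurableSet_sector ρ)]
    simp only [hvz]
    rfl

lemma stdGaussian_ae_ne_zero [Nontrivial E] : ∀ᵐ z ∂stdGaussian E, z ≠ 0 := by
  obtain ⟨u, hu⟩ := exists_norm_eq E zero_le_one
  have h : (stdGaussian E).map (fun z ↦ ⟪u, z⟫) {0} = 0 := by
    rw [stdGaussian_map_inner hu]
    have := nullSingletonClass_gaussianReal (μ := 0) (one_ne_zero (α := NNReal))
    exact measure_singleton 0
  rw [Measure.map_apply (by fun_prop) (measurableSet_singleton 0)] at h
  refine measure_mono_null (fun z hz ↦ ?_) h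
  have hz : z = 0 := by simpa using hz
  simp [hz]

lemma integral_max_inner_stdGaussian {u : E} (hu : ‖u‖ = 1) :
    ∫ z, max ⟪u, z⟫ 0 ∂stdGaussian E = (√(2 * π))⁻¹ := by
  rw [← integral_max_zero_gaussianReal, ← stdGaussian_map_inner hu,
    integral_map (by fun_prop) (by fun_prop)]

lemma integral_inner_sq_stdGaussian {u : E} (hu : ‖u‖ = 1) :
    ∫ z, ⟪u, z⟫ ^ 2 ∂stdGaussian E = 1 := by
  have h := variance_id_gaussianReal (μ := 0) (v := 1)
  rw [variance_eq_integral (by fun_prop)] at h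
  simp only [id_eq, integral_id_gaussianReal, sub_zero, NNReal.coe_one] at h
  rw [← h, ← stdGaussian_map_inner hu, integral_map (by fun_prop) (by fun_prop)]

lemma integrable_norm_sq_stdGaussian : Integrable (fun z ↦ ‖z‖ ^ 2) (stdGaussian E) := by
  simpa using (IsGaussian.memLp_two_id (μ := stdGaussian E)).integrable_norm_pow two_ne_zero

lemma integrable_norm_stdGaussian : Integrable (fun z ↦ ‖z‖) (stdGaussian E) :=
  IsGaussian.integrable_id.norm

lemma integral_norm_sq_stdGaussian :
    ∫ z, ‖z‖ ^ 2 ∂stdGaussian E = Module.finrank ℝ E := by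
  have b := stdOrthonormalBasis ℝ E
  have hint (i) : Integrable (fun z ↦ ⟪b i, z⟫ ^ 2) (stdGaussian E) := by
    refine integrable_norm_sq_stdGaussian.mono' (by fun_prop) (.of_forall fun z ↦ ?_)
    rw [norm_pow]
    have := norm_inner_le_norm (𝕜 := ℝ) (b i) z
    rw [b.norm_eq_one, one_mul] at this
    gcongr
  simp_rw [← b.sum_sq_inner_right]
  rw [integral_finsetSum _ fun i _ ↦ hint i]
  simp [integral_inner_sq_stdGaussian, b.norm_eq_one]

lemma integral_norm_stdGaussian_le [Nontrivial E] :
    ∫ z, ‖z‖ ∂stdGaussian E ≤ √(Module.finrank ℝ E) := by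
  have hd : (0 : ℝ) < Module.finrank ℝ E := by exact_mod_cast Module.finrank_pos
  set s := √(Module.finrank ℝ E : ℝ) with hs
  have hs0 : 0 < s := sqrt_pos.2 hd
  have hs2 : s ^ 2 = Module.finrank ℝ E := sq_sqrt hd.le
  have h : ∫ z, ‖z‖ ∂stdGaussian E ≤ ∫ z, ((2 * s)⁻¹ * ‖z‖ ^ 2 + s / 2) ∂stdGaussian E := by
    refine integral_mono integrable_norm_stdGaussian
      ((integrable_norm_sq_stdGaussian.const_mul _).add (integrable_const _)) fun z ↦ ?_
    change ‖z‖ ≤ (2 * s)⁻¹ * ‖z‖ ^ 2 + s / 2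
    have : (2 * s)⁻¹ * ‖z‖ ^ 2 + s / 2 - ‖z‖ = (2 * s)⁻¹ * (‖z‖ - s) ^ 2 := by
      field_simp
      ring
    have : 0 ≤ (2 * s)⁻¹ * (‖z‖ - s) ^ 2 := by positivity
    linarith
  rw [integral_add (integrable_norm_sq_stdGaussian.const_mul _) (integrable_const _),
    integral_const_mul, integral_norm_sq_stdGaussian, integral_const, ← hs2] at h
  refine h.trans_eq ?_
  simp
  field_simp
  ring

lemma integral_comp_inner_norm_stdGaussian_eq (F : ℝ → ℝ → ℝ) {u v : E} (h : ‖u‖ = ‖v‖) :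
    ∫ z, F ⟪u, z⟫ ‖z‖ ∂stdGaussian E = ∫ z, F ⟪v, z⟫ ‖z‖ ∂stdGaussian E := by
  obtain ⟨f, rfl⟩ : ∃ f : E ≃ₗᵢ[ℝ] E, f u = v := ⟨_, Submodule.reflection_sub h⟩
  conv_rhs => rw [← stdGaussian_map f]
  refine Eq.trans ?_ (f.toHomeomorph.measurableEmbedding.integral_map _).symm
  simp

omit [FiniteDimensional ℝ E] [MeasurableSpace E] [BorelSpace E] in
lemma norm_max_inner_div_norm_le {u : E} (hu : ‖u‖ = 1) (z : E) :
    ‖max ⟪u, z⟫ 0 / ‖z‖‖ ≤ 1 := by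
  rw [norm_eq_abs, abs_of_nonneg (by positivity)]
  have := real_inner_le_norm u z
  rw [hu, one_mul] at this
  exact div_le_one_of_le₀ (max_le this (norm_nonneg z)) (norm_nonneg z)

lemma integrable_max_inner_div_norm {u : E} (hu : ‖u‖ = 1) :
    Integrable (fun z ↦ max ⟪u, z⟫ 0 / ‖z‖) (stdGaussian E) :=
  .of_bound (by fun_prop : Measurable _).aestronglyMeasurable 1 (.of_forall (norm_max_inner_div_norm_le hu))

lemma integrable_inner_div_norm_sq {u : E} (hu : ‖u‖ = 1) :
    Integrable (fun z ↦ (⟪u, z⟫ / ‖z‖) ^ 2) (stdGaussian E) := by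
  refine .of_bound (by fun_prop : Measurable _).aestronglyMeasurable 1 (.of_forall fun z ↦ ?_)
  have h := abs_real_inner_le_norm u z
  rw [hu, one_mul] at h
  rw [norm_pow, norm_eq_abs, abs_div, abs_norm]
  exact pow_le_one₀ (by positivity) (div_le_one_of_le₀ h (norm_nonneg z))

lemma integral_inner_div_norm_sq [Nontrivial E] {u : E} (hu : ‖u‖ = 1) :
    ∫ z, (⟪u, z⟫ / ‖z‖) ^ 2 ∂stdGaussian E = (Module.finrank ℝ E : ℝ)⁻¹ := by
  have b := stdOrthonormalBasis ℝ E
  have h1 : ∑ i, ∫ z, (⟪b i, z⟫ / ‖z‖) ^ 2 ∂stdGaussian E = 1 := by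
    rw [← integral_finsetSum _ fun i _ ↦ integrable_inner_div_norm_sq (b.norm_eq_one i)]
    have h2 : (fun z ↦ ∑ i, (⟪b i, z⟫ / ‖z‖) ^ 2) =ᵐ[stdGaussian E] fun _ ↦ 1 := by
      filter_upwards [stdGaussian_ae_ne_zero (E := E)] with z hz
      have := norm_pos_iff.2 hz
      simp_rw [div_pow]
      rw [← Finset.sum_div, b.sum_sq_inner_right, div_self (by positivity)]
    rw [integral_congr_ae h2]
    simp
  have h3 (i) : ∫ z, (⟪b i, z⟫ / ‖z‖) ^ 2 ∂stdGaussian E =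
      ∫ z, (⟪u, z⟫ / ‖z‖) ^ 2 ∂stdGaussian E :=
    integral_comp_inner_norm_stdGaussian_eq (fun x y ↦ (x / y) ^ 2) (by rw [b.norm_eq_one, hu])
  simp only [h3, Finset.sum_const, Finset.card_univ, Fintype.card_fin, nsmul_eq_mul] at h1
  exact eq_inv_of_mul_eq_one_right h1

lemma integral_max_inner_div_norm_le [Nontrivial E] {u : E} (hu : ‖u‖ = 1) :
    ∫ z, max ⟪u, z⟫ 0 / ‖z‖ ∂stdGaussian E ≤ (2 * √(Module.finrank ℝ E))⁻¹ := by
  have hd : (0 : ℝ) < Module.finrank ℝ E := by exact_mod_cast Module.finrank_pos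
  set s := √(Module.finrank ℝ E : ℝ) with hs
  have hs0 : 0 < s := sqrt_pos.2 hd
  have hs2 : s ^ 2 = Module.finrank ℝ E := sq_sqrt hd.le
  have hnu : ‖-u‖ = 1 := by rwa [norm_neg]
  have hsymm := integral_comp_inner_norm_stdGaussian_eq (fun x y ↦ max x 0 / y)
    ((norm_neg u).symm)
  have h : ∫ z, (max ⟪u, z⟫ 0 / ‖z‖ + max ⟪-u, z⟫ 0 / ‖z‖) ∂stdGaussian E ≤
      ∫ z, (s / 2 * (⟪u, z⟫ / ‖z‖) ^ 2 + (2 * s)⁻¹) ∂stdGaussian E := by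
    refine integral_mono
      ((integrable_max_inner_div_norm hu).add (integrable_max_inner_div_norm hnu))
      (((integrable_inner_div_norm_sq hu).const_mul _).add (integrable_const _)) fun z ↦ ?_
    change max ⟪u, z⟫ 0 / ‖z‖ + max ⟪-u, z⟫ 0 / ‖z‖ ≤ s / 2 * (⟪u, z⟫ / ‖z‖) ^ 2 + (2 * s)⁻¹
    have h1 : max ⟪u, z⟫ 0 / ‖z‖ + max ⟪-u, z⟫ 0 / ‖z‖ = |⟪u, z⟫ / ‖z‖| := by
      rw [← add_div, inner_neg_left, abs_div, abs_norm]
      congr 1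
      rcases le_total 0 ⟪u, z⟫ with h | h
      · rw [max_eq_left h, max_eq_right (by linarith), abs_of_nonneg h, add_zero]
      · rw [max_eq_right h, max_eq_left (by linarith), abs_of_nonpos h, zero_add]
    rw [h1, ← sq_abs (⟪u, z⟫ / ‖z‖)]
    set t := |⟪u, z⟫ / ‖z‖|
    have h2 : s / 2 * t ^ 2 + (2 * s)⁻¹ - t = (2 * s)⁻¹ * (s * t - 1) ^ 2 := by
      field_simp
      ring
    have h3 : 0 ≤ (2 * s)⁻¹ * (s * t - 1) ^ 2 := by positivity
    linarith
  rw [integral_add (integrable_max_inner_div_norm hu) (integrable_max_inner_div_norm hnu),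
    integral_add ((integrable_inner_div_norm_sq hu).const_mul _) (integrable_const _),
    integral_const_mul, integral_inner_div_norm_sq hu, ← hs2, ← hsymm, integral_const] at h
  have h4 : s / 2 * (s ^ 2)⁻¹ + (2 * s)⁻¹ = 2 * (2 * s)⁻¹ := by
    field_simp
    ring
  simp only [probReal_univ, one_smul, h4] at h
  linarith

lemma integral_max_inner_div_norm_mul_integral_norm [Nontrivial E] {u : E} (hu : ‖u‖ = 1) :
    (∫ z, max ⟪u, z⟫ 0 / ‖z‖ ∂stdGaussian E) * ∫ z, ‖z‖ ∂stdGaussian E = (√(2 * π))⁻¹ := by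
  have hunit {x : E} (hx : x ≠ 0) : ‖‖x‖⁻¹ • x‖ = 1 := norm_smul_inv_norm hx
  have hscale (x z : E) : max ⟪x, z⟫ 0 = ‖x‖ * max ⟪‖x‖⁻¹ • x, z⟫ 0 := by
    rcases eq_or_ne x 0 with rfl | hx
    · simp
    · have := norm_pos_iff.2 hx
      rw [mul_max_of_nonneg _ _ (norm_nonneg x), inner_smul_left, mul_zero]
      simp [mul_inv_cancel_left₀ this.ne']
  have hint : Integrable (Function.uncurry fun x z : E ↦ max ⟪x, z⟫ 0 / ‖z‖)
      ((stdGaussian E).prod (stdGaussian E)) := by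
    refine (integrable_norm_stdGaussian.comp_fst _).mono'
      (by fun_prop : Measurable fun p : E × E ↦ max ⟪p.1, p.2⟫ 0 / ‖p.2‖).aestronglyMeasurable
      (.of_forall fun p ↦ ?_)
    rw [Function.uncurry_apply_pair, norm_eq_abs, abs_of_nonneg (by positivity)]
    refine div_le_of_le_mul₀ (norm_nonneg _) (norm_nonneg _) (max_le ?_ (by positivity))
    exact real_inner_le_norm _ _
  have hswap := integral_integral_swap hint
  have h1 : ∫ x, ∫ z, max ⟪x, z⟫ 0 / ‖z‖ ∂stdGaussian E ∂stdGaussian E =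
      (∫ z, max ⟪u, z⟫ 0 / ‖z‖ ∂stdGaussian E) * ∫ z, ‖z‖ ∂stdGaussian E := by
    rw [← integral_const_mul]
    refine integral_congr_ae ?_
    filter_upwards [stdGaussian_ae_ne_zero (E := E)] with x hx
    simp_rw [hscale x, mul_div_assoc]
    rw [integral_const_mul, integral_comp_inner_norm_stdGaussian_eq (fun x y ↦ max x 0 / y)
      ((hunit hx).trans hu.symm), mul_comm]
  have h2 : ∫ z, ∫ x, max ⟪x, z⟫ 0 / ‖z‖ ∂stdGaussian E ∂stdGaussian E = (√(2 * π))⁻¹ := by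
    have h3 : (fun z ↦ ∫ x, max ⟪x, z⟫ 0 / ‖z‖ ∂stdGaussian E) =ᵐ[stdGaussian E]
        fun _ ↦ (√(2 * π))⁻¹ := by
      filter_upwards [stdGaussian_ae_ne_zero (E := E)] with z hz
      have hz' := norm_pos_iff.2 hz
      simp_rw [real_inner_comm z, hscale z, mul_div_right_comm, div_self hz'.ne', one_mul]
      exact integral_max_inner_stdGaussian (hunit hz)
    rw [integral_congr_ae h3]
    simp
  rw [← h1, hswap, h2]

lemma lintegral_indicator_add_max_inner_div_norm {u : E} (hu : ‖u‖ = 1) {κ : ℝ} (hκ : 0 ≤ κ) :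
    ∫⁻ y, ENNReal.ofReal
        ({y | 0 ≤ ⟪u, y⟫}.indicator (fun _ ↦ 1 / 4) y + κ * (max ⟪u, y⟫ 0 / ‖y‖))
          ∂stdGaussian E =
      ENNReal.ofReal (1 / 8 + κ * ∫ z, max ⟪u, z⟫ 0 / ‖z‖ ∂stdGaussian E) := by
  have hm : MeasurableSet {y : E | 0 ≤ ⟪u, y⟫} := measurableSet_le (by fun_prop) (by fun_prop)
  have hi : Integrable ({y : E | 0 ≤ ⟪u, y⟫}.indicator fun _ ↦ (1 / 4 : ℝ)) (stdGaussian E) :=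
    (integrable_const _).indicator hm
  have hj := (integrable_max_inner_div_norm hu).const_mul κ
  refine (ofReal_integral_eq_lintegral_ofReal (hi.add hj) (.of_forall fun y ↦
    add_nonneg (Set.indicator_nonneg (by norm_num) y) (by positivity))).symm.trans ?_
  simp only [Pi.add_apply]
  rw [integral_add hi hj, integral_const_mul, integral_indicator_const _ hm, measureReal_def,
    stdGaussian_halfSpace hu]
  congr 2
  norm_num

lemma measurableSet_inner_nonneg_cyclic :
    MeasurableSet {p : E × E × E | 0 ≤ ⟪p.1, p.2.1⟫ ∧ 0 ≤ ⟪p.2.1, p.2.2⟫ ∧ 0 ≤ ⟪p.2.2, p.1⟫} :=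
  (measurableSet_le measurable_const
      (by fun_prop : Measurable fun p : E × E × E ↦ ⟪p.1, p.2.1⟫)).inter
    ((measurableSet_le measurable_const
      (by fun_prop : Measurable fun p : E × E × E ↦ ⟪p.2.1, p.2.2⟫)).inter
    (measurableSet_le measurable_const
      (by fun_prop : Measurable fun p : E × E × E ↦ ⟪p.2.2, p.1⟫)))

lemma stdGaussian_prod_bounds [Nontrivial E] {u : E} (hu : ‖u‖ = 1) :
    (stdGaussian E).prod (stdGaussian E)
        {q | 0 ≤ ⟪u, q.1⟫ ∧ 0 ≤ ⟪q.1, q.2⟫ ∧ 0 ≤ ⟪q.2, u⟫} ∈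
      Set.Icc
        (ENNReal.ofReal (1 / 8 + (2 * π)⁻¹ * ∫ z, max ⟪u, z⟫ 0 / ‖z‖ ∂stdGaussian E))
        (ENNReal.ofReal (1 / 8 + 1 / 4 * ∫ z, max ⟪u, z⟫ 0 / ‖z‖ ∂stdGaussian E)) := by
  have hπ := pi_pos
  have hslice : ∀ᵐ y ∂stdGaussian E,
      stdGaussian E {z | 0 ≤ ⟪u, y⟫ ∧ 0 ≤ ⟪y, z⟫ ∧ 0 ≤ ⟪z, u⟫} ∈ Set.Icc
        (ENNReal.ofReal ({y | 0 ≤ ⟪u, y⟫}.indicator (fun _ ↦ 1 / 4) y +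
          (2 * π)⁻¹ * (max ⟪u, y⟫ 0 / ‖y‖)))
        (ENNReal.ofReal ({y | 0 ≤ ⟪u, y⟫}.indicator (fun _ ↦ 1 / 4) y +
          1 / 4 * (max ⟪u, y⟫ 0 / ‖y‖))) := by
    filter_upwards [stdGaussian_ae_ne_zero (E := E)] with y hy
    have hy' := norm_pos_iff.2 hy
    by_cases h : 0 ≤ ⟪u, y⟫
    · have hin : ⟪u, ‖y‖⁻¹ • y⟫ = ⟪u, y⟫ / ‖y‖ := by
        rw [inner_smul_right, div_eq_inv_mul]
      have hset : {z | 0 ≤ ⟪u, y⟫ ∧ 0 ≤ ⟪y, z⟫ ∧ 0 ≤ ⟪z, u⟫} =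
          {z | 0 ≤ ⟪u, z⟫ ∧ 0 ≤ ⟪‖y‖⁻¹ • y, z⟫} := by
        ext z
        simp only [Set.mem_ofPred_eq, h, true_and, real_inner_smul_left,
          mul_nonneg_iff_of_pos_left (inv_pos.2 hy'), real_inner_comm u z]
        exact and_comm
      have hyu : ‖‖y‖⁻¹ • y‖ = 1 := norm_smul_inv_norm hy
      have hρ0 : 0 ≤ ⟪u, y⟫ / ‖y‖ := by positivity
      have hρ1 : ⟪u, y⟫ / ‖y‖ ≤ 1 := by
        refine div_le_one_of_le₀ ?_ (norm_nonneg y)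
        simpa [hu] using real_inner_le_norm u y
      rw [hset, stdGaussian_wedge hu hyu (hin ▸ hρ0), hin,
        Set.indicator_of_mem (show y ∈ {y | 0 ≤ ⟪u, y⟫} from h), max_eq_left h]
      generalize ⟪u, y⟫ / ‖y‖ = ρ at hρ0 hρ1
      have ha := arcsin_nonneg.2 hρ0
      have hsin := sin_arcsin (by linarith) hρ1
      have h1 := sin_le ha
      have h2 := mul_le_sin ha (arcsin_le_pi_div_two ρ)
      rw [hsin] at h1 h2
      constructor <;> refine ENNReal.ofReal_le_ofReal (add_le_add_right ?_ _)
      · rw [div_eq_inv_mul]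
        gcongr
      · rw [div_le_iff₀ (by positivity)]
        rw [div_mul_eq_mul_div, div_le_iff₀ hπ] at h2
        linarith
    · rw [Set.indicator_of_notMem (show y ∉ {y | 0 ≤ ⟪u, y⟫} from h),
        max_eq_right (not_le.1 h).le]
      simp [h]
  have hm : MeasurableSet {q : E × E | 0 ≤ ⟪u, q.1⟫ ∧ 0 ≤ ⟪q.1, q.2⟫ ∧ 0 ≤ ⟪q.2, u⟫} :=
    measurable_prodMk_left (x := u) measurableSet_inner_nonneg_cyclic
  rw [Measure.prod_apply hm, ← lintegral_indicator_add_max_inner_div_norm hu (by positivity),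
    ← lintegral_indicator_add_max_inner_div_norm hu (by positivity)]
  exact ⟨lintegral_mono_ae (hslice.mono fun y hy ↦ hy.1),
    lintegral_mono_ae (hslice.mono fun y hy ↦ hy.2)⟩

lemma stdGaussian_prod_prod_bounds [Nontrivial E] :
    (stdGaussian E).prod ((stdGaussian E).prod (stdGaussian E))
        {p | 0 ≤ ⟪p.1, p.2.1⟫ ∧ 0 ≤ ⟪p.2.1, p.2.2⟫ ∧ 0 ≤ ⟪p.2.2, p.1⟫} ∈
      Set.Icc
        (ENNReal.ofReal (1 / 8 + (2 * π)⁻¹ * (√(2 * π) * √(Module.finrank ℝ E))⁻¹))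
        (ENNReal.ofReal (1 / 8 + 1 / 4 * (2 * √(Module.finrank ℝ E))⁻¹)) := by
  have hslice : ∀ᵐ x ∂stdGaussian E, (stdGaussian E).prod (stdGaussian E)
        {q | 0 ≤ ⟪x, q.1⟫ ∧ 0 ≤ ⟪q.1, q.2⟫ ∧ 0 ≤ ⟪q.2, x⟫} ∈ Set.Icc
        (ENNReal.ofReal (1 / 8 + (2 * π)⁻¹ * (√(2 * π) * √(Module.finrank ℝ E))⁻¹))
        (ENNReal.ofReal (1 / 8 + 1 / 4 * (2 * √(Module.finrank ℝ E))⁻¹)) := by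
    filter_upwards [stdGaussian_ae_ne_zero (E := E)] with x hx
    have hx' := inv_pos.2 (norm_pos_iff.2 hx)
    have hu : ‖‖x‖⁻¹ • x‖ = 1 := norm_smul_inv_norm hx
    have h := stdGaussian_prod_bounds hu
    simp only [real_inner_smul_left, real_inner_smul_right,
      mul_nonneg_iff_of_pos_left hx'] at h
    simp only [← real_inner_smul_left] at h
    have hc := integral_max_inner_div_norm_mul_integral_norm hu
    have hR := integral_norm_stdGaussian_le (E := E)
    have hC := integral_max_inner_div_norm_le hu
    have hc0 : 0 ≤ ∫ z, max ⟪‖x‖⁻¹ • x, z⟫ 0 / ‖z‖ ∂stdGaussian E :=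
      integral_nonneg fun z ↦ by positivity
    have hd : (0 : ℝ) < Module.finrank ℝ E := by exact_mod_cast Module.finrank_pos
    have hlow : (√(2 * π) * √(Module.finrank ℝ E))⁻¹ ≤
        ∫ z, max ⟪‖x‖⁻¹ • x, z⟫ 0 / ‖z‖ ∂stdGaussian E := by
      rw [mul_inv, ← hc, ← div_eq_mul_inv, div_le_iff₀ (sqrt_pos.2 hd)]
      gcongr
    exact ⟨(ENNReal.ofReal_le_ofReal (by gcongr)).trans h.1,
      h.2.trans (ENNReal.ofReal_le_ofReal (by gcongr))⟩
  rw [Measure.prod_apply measurableSet_inner_nonneg_cyclic]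
  constructor
  · calc _ = ∫⁻ _, _ ∂stdGaussian E := by rw [lintegral_const, measure_univ, mul_one]
      _ ≤ _ := lintegral_mono_ae (hslice.mono fun y hy ↦ hy.1)
  · calc _ ≤ ∫⁻ _, _ ∂stdGaussian E := lintegral_mono_ae (hslice.mono fun y hy ↦ hy.2)
      _ = _ := by rw [lintegral_const, measure_univ, mul_one]

end StdGaussian

lemma uniformSphere_eq_map_stdGaussian (d : ℕ) :
    uniformSphere d = (stdGaussian (EuclideanSpace ℝ (Fin d))).map
      fun z ↦ ‖z‖⁻¹ • WithLp.ofLp z := by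
  rw [uniformSphere, ← map_pi_eq_stdGaussian, Measure.map_map (by fun_prop) (by fun_prop)]
  congr 1
  ext z i
  simp [EuclideanSpace.norm_eq]

lemma uniformSphere_prod_prod_inner_nonneg (d : ℕ) :
    (uniformSphere d).prod ((uniformSphere d).prod (uniformSphere d))
        {p | 0 ≤ ∑ i, p.1 i * p.2.1 i ∧ 0 ≤ ∑ i, p.2.1 i * p.2.2 i ∧
          0 ≤ ∑ i, p.2.2 i * p.1 i} =
      (stdGaussian (EuclideanSpace ℝ (Fin d))).prod
        ((stdGaussian (EuclideanSpace ℝ (Fin d))).prod (stdGaussian (EuclideanSpace ℝ (Fin d))))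
        {p | 0 ≤ inner ℝ p.1 p.2.1 ∧ 0 ≤ inner ℝ p.2.1 p.2.2 ∧ 0 ≤ inner ℝ p.2.2 p.1} := by
  have hf : Measurable fun z : EuclideanSpace ℝ (Fin d) ↦ ‖z‖⁻¹ • WithLp.ofLp z := by fun_prop
  have hnonneg (x y : EuclideanSpace ℝ (Fin d)) :
      0 ≤ ∑ i, (‖x‖⁻¹ • WithLp.ofLp x) i * (‖y‖⁻¹ • WithLp.ofLp y) i ↔ 0 ≤ inner ℝ x y := by
    have h : ∑ i, (‖x‖⁻¹ • WithLp.ofLp x) i * (‖y‖⁻¹ • WithLp.ofLp y) i =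
        ‖x‖⁻¹ * ‖y‖⁻¹ * inner ℝ x y := by
      rw [PiLp.inner_apply, Finset.mul_sum]
      refine Finset.sum_congr rfl fun i _ ↦ ?_
      simp only [Pi.smul_apply, smul_eq_mul, RCLike.inner_apply, conj_trivial]
      ring
    rw [h]
    rcases eq_or_ne x 0 with rfl | hx
    · simp
    rcases eq_or_ne y 0 with rfl | hy
    · simp
    have := norm_pos_iff.2 hx
    have := norm_pos_iff.2 hy
    exact mul_nonneg_iff_of_pos_left (by positivity)
  rw [uniformSphere_eq_map_stdGaussian, Measure.map_prod_map _ _ hf hf,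
    Measure.map_prod_map _ _ hf (hf.prodMap hf),
    Measure.map_apply (hf.prodMap (hf.prodMap hf))]
  · congr 1
    ext p
    simp only [Set.mem_preimage, Set.mem_ofPred_eq, Prod.map_fst, Prod.map_snd, hnonneg]
  · exact (measurableSet_le measurable_const (by fun_prop : Measurable
        fun p : (Fin d → ℝ) × (Fin d → ℝ) × (Fin d → ℝ) ↦ ∑ i, p.1 i * p.2.1 i)).inter
      ((measurableSet_le measurable_const (by fun_prop : Measurable
        fun p : (Fin d → ℝ) × (Fin d → ℝ) × (Fin d → ℝ) ↦ ∑ i, p.2.1 i * p.2.2 i)).inter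
      (measurableSet_le measurable_const (by fun_prop : Measurable
        fun p : (Fin d → ℝ) × (Fin d → ℝ) × (Fin d → ℝ) ↦ ∑ i, p.2.2 i * p.1 i)))

/-- For `x₁, x₂, x₃` independent uniform on `S^{d−1}` (`d ≥ 2`),
`P(⟨x₁,x₂⟩ ≥ 0, ⟨x₂,x₃⟩ ≥ 0, ⟨x₃,x₁⟩ ≥ 0) − 1/8` lies between
`1/(2π√(2π)√d)` and `1/(4√π√d)`. -/
theorem triangle_probability_bounds (d : ℕ) (hd : 2 ≤ d) :
    1 / (2 * Real.pi * Real.sqrt (2 * Real.pi)) * (1 / Real.sqrt d) ≤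
      (((uniformSphere d).prod ((uniformSphere d).prod (uniformSphere d)))
          {p | 0 ≤ ∑ i, p.1 i * p.2.1 i ∧ 0 ≤ ∑ i, p.2.1 i * p.2.2 i ∧
            0 ≤ ∑ i, p.2.2 i * p.1 i}).toReal - 1 / 8 ∧
    (((uniformSphere d).prod ((uniformSphere d).prod (uniformSphere d)))
        {p | 0 ≤ ∑ i, p.1 i * p.2.1 i ∧ 0 ≤ ∑ i, p.2.1 i * p.2.2 i ∧
          0 ≤ ∑ i, p.2.2 i * p.1 i}).toReal - 1 / 8 ≤
      1 / (4 * Real.sqrt Real.pi) * (1 / Real.sqrt d) := by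
  have : Nontrivial (EuclideanSpace ℝ (Fin d)) :=
    Module.nontrivial_of_finrank_pos (R := ℝ) (by rw [finrank_euclideanSpace_fin]; omega)
  have hd0 : (0 : ℝ) < d := by exact_mod_cast (by omega : 0 < d)
  have hsd : 0 < √(d : ℝ) := sqrt_pos.2 hd0
  obtain ⟨hl, hu⟩ := stdGaussian_prod_prod_bounds (E := EuclideanSpace ℝ (Fin d))
  rw [finrank_euclideanSpace_fin] at hl hu
  rw [uniformSphere_prod_prod_inner_nonneg]
  have hl' := (ENNReal.ofReal_le_iff_le_toReal (measure_ne_top _ _)).1 hl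
  have hu' := ENNReal.toReal_le_of_le_ofReal (by positivity) hu
  constructor
  · refine (Eq.le ?_).trans (le_sub_iff_add_le'.2 hl')
    simp only [one_div, mul_inv]
    ring
  · refine (sub_le_iff_le_add'.2 hu').trans ?_
    have hπ : √π ≤ 2 := by
      rw [sqrt_le_left (by norm_num)]
      linarith [pi_le_four]
    have hπ0 : 0 < √π := sqrt_pos.2 pi_pos
    rw [one_div_mul_one_div, ← one_div, one_div_mul_one_div]
    refine one_div_le_one_div_of_le (by positivity) ?_
    nlinarith
end

section
/- Let p ∈ (0,1/2] be fixed and for each dimension d let t_{p,d} be defined by P(z₁/‖z‖ ≥ t_{p,d}) = p for z a standard Gaussian vector in ℝ^d. Then there is a constant C_p such that for all sufficiently large d, |t_{p,d}√d − Φ^{−1}(1−p)| ≤ C_p/d. -/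
open MeasureTheory ProbabilityTheory Real

/-- The standard Gaussian measure on `ℝ^d`. -/
noncomputable def stdGaussian (d : ℕ) : Measure (Fin d → ℝ) :=
  Measure.pi fun _ : Fin d => gaussianReal 0 1

/-- The upper tail of the standard normal distribution. -/
noncomputable def gaussianTail (x : ℝ) : ℝ := (gaussianReal 0 1).real (Set.Ici x)

lemma gaussianTail_antitone : Antitone gaussianTail := fun _ _ h =>
  measureReal_mono (Set.Ici_subset_Ici.2 h)

lemma hasDerivAt_gaussianPDFReal_zero_one (x : ℝ) :
    HasDerivAt (gaussianPDFReal 0 1) (-x * gaussianPDFReal 0 1 x) x := by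
  have h : HasDerivAt (fun y : ℝ => -(y - 0) ^ 2 / (2 * ((1 : NNReal) : ℝ))) (-x) x := by
    have := (((hasDerivAt_id x).sub_const 0).pow 2).neg.div_const (2 * ((1 : NNReal) : ℝ))
    convert! this using 1
    simp
    ring
  have h2 := h.exp.const_mul (√(2 * π * ((1 : NNReal) : ℝ)))⁻¹
  convert! h2 using 1
  rw [gaussianPDFReal_def]
  ring

lemma gaussianPDFReal_zero_one_le (x : ℝ) :
    gaussianPDFReal 0 1 x ≤ rexp (-x ^ 2 / 2) := by
  rw [gaussianPDFReal_def]
  have h1 : (1 : ℝ) ≤ √(2 * π * ((1 : NNReal) : ℝ)) := by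
    rw [Real.one_le_sqrt]
    have := Real.pi_gt_three
    push_cast
    linarith
  have h2 := inv_le_one_of_one_le₀ h1
  simp only [sub_zero, NNReal.coe_one, mul_one] at h2 ⊢
  exact mul_le_of_le_one_left (Real.exp_pos _).le h2

lemma abs_mul_gaussianPDFReal_zero_one_le (x : ℝ) : |x| * gaussianPDFReal 0 1 x ≤ 1 := by
  have h1 : |x| ≤ rexp (x ^ 2 / 2) := by
    have := Real.add_one_le_exp (x ^ 2 / 2)
    have h3 : |x| ^ 2 = x ^ 2 := sq_abs x
    nlinarith [sq_nonneg (|x| - 1)]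
  calc |x| * gaussianPDFReal 0 1 x ≤ rexp (x ^ 2 / 2) * rexp (-x ^ 2 / 2) :=
        mul_le_mul h1 (gaussianPDFReal_zero_one_le x) (gaussianPDFReal_nonneg _ _ _)
          (Real.exp_pos _).le
    _ = 1 := by rw [← Real.exp_add]; simp [neg_div]

lemma abs_gaussianPDFReal_zero_one_sub_le (x y : ℝ) :
    |gaussianPDFReal 0 1 y - gaussianPDFReal 0 1 x| ≤ |y - x| := by
  have := Convex.norm_image_sub_le_of_norm_hasDerivWithin_le (C := 1) (s := Set.univ)
    (f := gaussianPDFReal 0 1) (f' := fun x => -x * gaussianPDFReal 0 1 x)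
    (fun x _ => (hasDerivAt_gaussianPDFReal_zero_one x).hasDerivWithinAt)
    (fun x _ => by
      rw [norm_mul, norm_neg, Real.norm_eq_abs, Real.norm_eq_abs,
        abs_of_nonneg (gaussianPDFReal_nonneg _ _ _)]
      exact abs_mul_gaussianPDFReal_zero_one_le x)
    convex_univ (Set.mem_univ x) (Set.mem_univ y)
  simpa using this

lemma gaussianTail_eq_integral (x : ℝ) :
    gaussianTail x = ∫ u in Set.Ioi x, gaussianPDFReal 0 1 u := by
  rw [gaussianTail, measureReal_def, gaussianReal_apply_eq_integral 0 one_ne_zero,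
    integral_Ici_eq_integral_Ioi, ENNReal.toReal_ofReal]
  exact setIntegral_nonneg measurableSet_Ioi fun u _ => gaussianPDFReal_nonneg _ _ _

/-- Second-order Taylor estimate for the Gaussian tail. -/
lemma abs_gaussianTail_sub_add_le (a y : ℝ) :
    |gaussianTail y - gaussianTail a + gaussianPDFReal 0 1 a * (y - a)| ≤ (y - a) ^ 2 := by
  have hi : Integrable (gaussianPDFReal 0 1) := integrable_gaussianPDFReal 0 1
  have h1 : gaussianTail a - gaussianTail y = ∫ u in a..y, gaussianPDFReal 0 1 u := by
    rw [gaussianTail_eq_integral, gaussianTail_eq_integral,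
      intervalIntegral.integral_Ioi_sub_Ioi' hi.integrableOn hi.integrableOn]
  have h2 : gaussianTail y - gaussianTail a + gaussianPDFReal 0 1 a * (y - a)
      = -∫ u in a..y, (gaussianPDFReal 0 1 u - gaussianPDFReal 0 1 a) := by
    rw [intervalIntegral.integral_sub hi.intervalIntegrable (by simp), ← h1]
    simp
    ring
  rw [h2, abs_neg]
  have h3 := intervalIntegral.norm_integral_le_of_norm_le_const (a := a) (b := y) (C := |y - a|)
    (f := fun u => gaussianPDFReal 0 1 u - gaussianPDFReal 0 1 a) (fun u hu => by
      refine (abs_gaussianPDFReal_zero_one_sub_le a u).trans ?_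
      exact Set.abs_sub_left_of_mem_uIcc (Set.uIoc_subset_uIcc hu))
  rwa [abs_mul_abs_self, ← pow_two, Real.norm_eq_abs] at h3

lemma abs_gaussianTail_mul_sqrt_sub_le (a : ℝ) {w : ℝ} (hw : 0 ≤ w) :
    |gaussianTail (a * √w) - gaussianTail a + gaussianPDFReal 0 1 a * a / 2 * (w - 1)|
      ≤ (a ^ 2 + |a|) * (w - 1) ^ 2 := by
  obtain ⟨s, hs0, rfl⟩ : ∃ s : ℝ, 0 ≤ s ∧ w = s ^ 2 := ⟨√w, Real.sqrt_nonneg w, (Real.sq_sqrt hw).symm⟩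
  rw [Real.sqrt_sq hs0]
  have h1 := abs_gaussianTail_sub_add_le a (a * s)
  have h2 : gaussianPDFReal 0 1 a ≤ 1 :=
    (gaussianPDFReal_zero_one_le a).trans (Real.exp_le_one_iff.2 (by nlinarith [sq_nonneg a]))
  have h3 : (s - 1) ^ 2 ≤ (s ^ 2 - 1) ^ 2 := by
    nlinarith [mul_nonneg (sq_nonneg (s - 1)) (by positivity : 0 ≤ s ^ 2 + 2 * s)]
  have h4 : |gaussianPDFReal 0 1 a * a * (s - 1) ^ 2 / 2| ≤ |a| * (s - 1) ^ 2 := by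
    rw [abs_div, abs_mul, abs_mul, abs_of_nonneg (gaussianPDFReal_nonneg _ _ _),
      abs_of_nonneg (sq_nonneg (s - 1)), abs_of_pos (two_pos : (0 : ℝ) < 2)]
    have h5 : 0 ≤ |a| * (s - 1) ^ 2 := by positivity
    nlinarith [mul_le_mul_of_nonneg_right h2 h5]
  calc _ = |(gaussianTail (a * s) - gaussianTail a + gaussianPDFReal 0 1 a * (a * s - a))
          + gaussianPDFReal 0 1 a * a * (s - 1) ^ 2 / 2| := by ring_nf
    _ ≤ (a * s - a) ^ 2 + |a| * (s - 1) ^ 2 := (abs_add_le _ _).trans (add_le_add h1 h4)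
    _ = (a ^ 2 + |a|) * (s - 1) ^ 2 := by ring
    _ ≤ _ := by gcongr

/-- The average of the squares of the coordinates. -/
noncomputable def meanSquare (n : ℕ) (y : Fin n → ℝ) : ℝ := (∑ i, y i ^ 2) / n

lemma meanSquare_nonneg (n : ℕ) (y : Fin n → ℝ) : 0 ≤ meanSquare n y := by
  unfold meanSquare; positivity

lemma measurable_meanSquare (n : ℕ) : Measurable (meanSquare n) := by
  unfold meanSquare; fun_prop

lemma memLp_sq_gaussianReal : MemLp (fun x : ℝ => x ^ 2) 2 (gaussianReal 0 1) := by
  rw [memLp_two_iff_integrable_sq (by fun_prop)]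
  have h := (memLp_id_gaussianReal (μ := 0) (v := 1) 4).integrable_norm_pow (p := 4) (by simp)
  refine h.congr (ae_of_all _ fun x => ?_)
  simp only [id, Real.norm_eq_abs]
  rw [← pow_mul, ← abs_pow, abs_of_nonneg (by positivity)]

lemma integral_sq_gaussianReal_zero_one : ∫ x, x ^ 2 ∂(gaussianReal 0 1) = 1 := by
  have h := variance_eq_sub (memLp_id_gaussianReal (μ := 0) (v := 1) 2)
  rw [variance_id_gaussianReal] at h
  simpa [integral_id_gaussianReal] using h.symm

instance (n : ℕ) : IsProbabilityMeasure (_root_.stdGaussian n) := by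
  unfold _root_.stdGaussian; infer_instance

lemma memLp_meanSquare (n : ℕ) : MemLp (meanSquare n) 2 (_root_.stdGaussian n) := by
  have h : MemLp (fun y : Fin n → ℝ => ∑ i, y i ^ 2) 2 (_root_.stdGaussian n) :=
    memLp_finsetSum _ fun i _ =>
      memLp_sq_gaussianReal.comp_measurePreserving
        (measurePreserving_eval (fun _ : Fin n => gaussianReal 0 1) i)
  convert! h.const_mul ((n : ℝ)⁻¹) using 2
  exact div_eq_inv_mul _ _

lemma integral_meanSquare {n : ℕ} (hn : n ≠ 0) :
    ∫ y, meanSquare n y ∂(_root_.stdGaussian n) = 1 := by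
  have h : ∀ i : Fin n, ∫ y : Fin n → ℝ, y i ^ 2 ∂(_root_.stdGaussian n) = 1 := fun i => by
    rw [← integral_sq_gaussianReal_zero_one]
    exact integral_comp_eval (μ := fun _ : Fin n => gaussianReal 0 1) (i := i)
      (f := fun x : ℝ => x ^ 2) (by fun_prop)
  simp only [meanSquare]
  rw [integral_div, integral_finsetSum]
  · simp [h, hn]
  · intro i _
    exact integrable_comp_eval (μ := fun _ : Fin n => gaussianReal 0 1) (i := i)
      (memLp_sq_gaussianReal.integrable one_le_two)

lemma integral_meanSquare_sub_one_sq {n : ℕ} (hn : n ≠ 0) :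
    ∫ y, (meanSquare n y - 1) ^ 2 ∂(_root_.stdGaussian n)
      = Var[fun x : ℝ => x ^ 2; gaussianReal 0 1] / n := by
  have h := variance_sum_pi (μ := fun _ : Fin n => gaussianReal 0 1)
    (X := fun _ (x : ℝ) => x ^ 2) fun _ => memLp_sq_gaussianReal
  have h2 := variance_eq_integral (measurable_meanSquare n).aemeasurable
    (μ := _root_.stdGaussian n)
  rw [integral_meanSquare hn] at h2
  have h3 : meanSquare n = fun y => (n : ℝ)⁻¹ * (∑ i, fun y : Fin n → ℝ => y i ^ 2) y := by
    ext y
    simp [meanSquare, div_eq_inv_mul]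
  rw [← h2, h3, variance_const_mul, _root_.stdGaussian, h]
  simp
  field_simp

lemma stdGaussian_succ_real_eq_integral (n : ℕ) (a : ℝ) :
    (_root_.stdGaussian (n + 1)).real {z | a * √(meanSquare n fun i => z i.succ) ≤ z 0}
      = ∫ y, gaussianTail (a * √(meanSquare n y)) ∂(_root_.stdGaussian n) := by
  have hs : MeasurableSet {q : ℝ × (Fin n → ℝ) | a * √(meanSquare n q.2) ≤ q.1} := by
    have := measurable_meanSquare n
    exact measurableSet_le (by fun_prop) (by fun_prop)
  have hmp := measurePreserving_piFinSuccAbove (fun _ : Fin (n + 1) => gaussianReal 0 1) 0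
  have h1 : (_root_.stdGaussian (n + 1)) {z | a * √(meanSquare n fun i => z i.succ) ≤ z 0}
      = ((gaussianReal 0 1).prod (_root_.stdGaussian n))
        {q : ℝ × (Fin n → ℝ) | a * √(meanSquare n q.2) ≤ q.1} :=
    hmp.measure_preimage hs.nullMeasurableSet
  have h2 : ∀ y : Fin n → ℝ, gaussianTail (a * √(meanSquare n y))
      = ((gaussianReal 0 1) (Set.Ici (a * √(meanSquare n y)))).toReal := fun y => rfl
  rw [measureReal_def, h1, Measure.prod_apply_symm hs]
  simp_rw [h2]
  rw [integral_toReal]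
  · rfl
  · exact (measurable_measure_prodMk_right hs).aemeasurable
  · exact ae_of_all _ fun y => measure_lt_top _ _

lemma abs_stdGaussian_succ_real_sub_gaussianTail_le {n : ℕ} (hn : n ≠ 0) (a : ℝ) :
    |(_root_.stdGaussian (n + 1)).real {z | a * √(meanSquare n fun i => z i.succ) ≤ z 0}
        - gaussianTail a|
      ≤ (a ^ 2 + |a|) * (Var[fun x : ℝ => x ^ 2; gaussianReal 0 1] / n) := by
  set W := meanSquare n with hW
  have hWm : Measurable W := measurable_meanSquare n
  have hW1 : Integrable (fun y => W y - 1) (_root_.stdGaussian n) :=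
    ((memLp_meanSquare n).integrable one_le_two).sub (integrable_const 1)
  have hW2 : Integrable (fun y => (W y - 1) ^ 2) (_root_.stdGaussian n) :=
    ((memLp_meanSquare n).sub (memLp_const 1)).integrable_sq
  have hT : Integrable (fun y => gaussianTail (a * √(W y))) (_root_.stdGaussian n) := by
    refine Integrable.of_bound (C := 1)
      (gaussianTail_antitone.measurable.comp (by fun_prop)).aestronglyMeasurable
      (ae_of_all _ fun y => ?_)
    rw [Real.norm_eq_abs, gaussianTail, abs_of_nonneg measureReal_nonneg]
    exact measureReal_le_one
  have h0 : ∫ y, (W y - 1) ∂(_root_.stdGaussian n) = 0 := by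
    rw [integral_sub ((memLp_meanSquare n).integrable one_le_two) (integrable_const 1),
      integral_meanSquare hn]
    simp
  have h1 : (∫ y, gaussianTail (a * √(W y)) ∂(_root_.stdGaussian n)) - gaussianTail a
      = ∫ y, (gaussianTail (a * √(W y)) - gaussianTail a
          + gaussianPDFReal 0 1 a * a / 2 * (W y - 1)) ∂(_root_.stdGaussian n) := by
    rw [integral_add (f := fun y => gaussianTail (a * √(W y)) - gaussianTail a)
      (hT.sub (integrable_const _)) (hW1.const_mul _), integral_sub hT (integrable_const _),
      integral_const_mul, h0]
    simp
  rw [stdGaussian_succ_real_eq_integral, h1, ← integral_meanSquare_sub_one_sq hn,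
    ← integral_const_mul, ← Real.norm_eq_abs]
  refine norm_integral_le_of_norm_le (hW2.const_mul _) (ae_of_all _ fun y => ?_)
  exact abs_gaussianTail_mul_sqrt_sub_le a (meanSquare_nonneg n y)

lemma div_sqrt_le_div_sqrt_iff {n a x r : ℝ} (hn : 0 < n) (hx : x ≠ 0) (hr : 0 ≤ r) :
    a / √(n + a ^ 2) ≤ x / √(x ^ 2 + n * r ^ 2) ↔ a * r ≤ x := by
  have hx2 : 0 < x ^ 2 := by positivity
  have hA : 0 < √(n + a ^ 2) := Real.sqrt_pos.2 (by positivity)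
  have hB : 0 < √(x ^ 2 + n * r ^ 2) := Real.sqrt_pos.2 (by positivity)
  have hA2 : √(n + a ^ 2) ^ 2 = n + a ^ 2 := Real.sq_sqrt (by positivity)
  have hB2 : √(x ^ 2 + n * r ^ 2) ^ 2 = x ^ 2 + n * r ^ 2 := Real.sq_sqrt (by positivity)
  rw [div_le_div_iff₀ hA hB]
  set A := √(n + a ^ 2)
  set B := √(x ^ 2 + n * r ^ 2)
  have key : (x * A) ^ 2 - (a * B) ^ 2 = n * (x ^ 2 - (a * r) ^ 2) := by
    rw [mul_pow, mul_pow, hA2, hB2]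
    ring
  rcases lt_or_gt_of_ne hx with hx0 | hx0 <;> rcases le_or_gt 0 a with ha | ha
  · have h1 : x * A < 0 := mul_neg_of_neg_of_pos hx0 hA
    have h2 : 0 ≤ a * B := by positivity
    have h3 : 0 ≤ a * r := by positivity
    constructor <;> intro h <;> linarith
  · have h1 : x * A < 0 := mul_neg_of_neg_of_pos hx0 hA
    have h2 : a * B < 0 := mul_neg_of_neg_of_pos ha hB
    have h3 : a * r ≤ 0 := mul_nonpos_of_nonpos_of_nonneg ha.le hr
    constructor <;> intro h <;> by_contra! hc
    · have h4 : (x * A) ^ 2 ≤ (a * B) ^ 2 := by nlinarith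
      have h5 : (a * r) ^ 2 < x ^ 2 := by nlinarith
      linarith [mul_pos hn (sub_pos.2 h5)]
    · have h4 : (a * B) ^ 2 < (x * A) ^ 2 := by nlinarith
      have h5 : x ^ 2 ≤ (a * r) ^ 2 := by nlinarith
      linarith [mul_nonneg hn.le (sub_nonneg.2 h5)]
  · have h1 : 0 < x * A := by positivity
    have h2 : 0 ≤ a * B := by positivity
    have h3 : 0 ≤ a * r := by positivity
    rw [← pow_le_pow_iff_left₀ h2 h1.le two_ne_zero, ← pow_le_pow_iff_left₀ h3 hx0.le two_ne_zero,
      ← sub_nonneg, key, ← sub_nonneg (a := x ^ 2)]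
    exact mul_nonneg_iff_of_pos_left hn
  · have h1 : 0 < x * A := by positivity
    have h2 : a * B < 0 := mul_neg_of_neg_of_pos ha hB
    have h3 : a * r ≤ 0 := mul_nonpos_of_nonpos_of_nonneg ha.le hr
    constructor <;> intro h <;> linarith

lemma stdGaussian_succ_real_div_sqrt {n : ℕ} (hn : n ≠ 0) (a : ℝ) :
    (_root_.stdGaussian (n + 1)).real {z | a / √(n + a ^ 2) ≤ z 0 / √(∑ i, z i ^ 2)}
      = (_root_.stdGaussian (n + 1)).real {z | a * √(meanSquare n fun i => z i.succ) ≤ z 0} := by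
  have hn0 : (0 : ℝ) < n := by positivity
  have hz : ∀ᵐ z ∂(_root_.stdGaussian (n + 1)), z 0 ≠ 0 := by
    have h : ∀ᵐ x ∂(gaussianReal 0 1), x ≠ 0 := by
      have := nullSingletonClass_gaussianReal (μ := 0) (v := 1) one_ne_zero
      exact Measure.ae_ne _ _
    exact (measurePreserving_eval (fun _ : Fin (n + 1) => gaussianReal 0 1)
      0).quasiMeasurePreserving.ae h
  refine measureReal_congr ?_
  filter_upwards [hz] with z hz
  have h1 : ∑ i, z i ^ 2 = z 0 ^ 2 + n * √(meanSquare n fun i => z i.succ) ^ 2 := by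
    rw [Real.sq_sqrt (meanSquare_nonneg _ _), Fin.sum_univ_succ, meanSquare]
    field_simp
  refine propext ?_
  change a / √(n + a ^ 2) ≤ z 0 / √(∑ i, z i ^ 2) ↔ _
  rw [h1]
  exact div_sqrt_le_div_sqrt_iff hn0 hz (Real.sqrt_nonneg _)

lemma abs_div_sqrt_mul_sqrt_sub_le {n a M : ℝ} (hn : 0 < n) (ha : |a| ≤ M) :
    |a / √(n + a ^ 2) * √(n + 1) - a| ≤ M * (1 + M ^ 2) / n := by
  have hA2 : √(n + a ^ 2) ^ 2 = n + a ^ 2 := Real.sq_sqrt (by positivity)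
  have hB2 : √(n + 1) ^ 2 = n + 1 := Real.sq_sqrt (by positivity)
  have hA : 0 < √(n + a ^ 2) := Real.sqrt_pos.2 (by positivity)
  have hB : 0 < √(n + 1) := Real.sqrt_pos.2 (by positivity)
  set A := √(n + a ^ 2)
  set B := √(n + 1)
  have hM : 0 ≤ M := (abs_nonneg a).trans ha
  have ha2 : a ^ 2 ≤ M ^ 2 := sq_le_sq' (by linarith [neg_abs_le a]) (by linarith [le_abs_self a])
  have h1 : a / A * B - a = a * ((1 - a ^ 2) / (A * (A + B))) := by
    field_simp
    linear_combination a * (hB2 - hA2)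
  have h2 : |(1 - a ^ 2) / (A * (A + B))| ≤ (1 + M ^ 2) / n := by
    rw [abs_div, abs_of_pos (by positivity : 0 < A * (A + B))]
    refine div_le_div₀ (by positivity) ?_ hn (by nlinarith [mul_pos hA hB, sq_nonneg a])
    rw [abs_le]
    constructor <;> nlinarith [sq_nonneg a]
  rw [h1, abs_mul, mul_div_assoc]
  exact mul_le_mul ha h2 (abs_nonneg _) hM

lemma gaussianTail_injective : Function.Injective gaussianTail := by
  refine StrictAnti.injective fun a b hab => ?_
  have hd : Set.Ici a \ Set.Ici b = Set.Ico a b := by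
    ext x
    simp
  have h := measureReal_sdiff (μ := gaussianReal 0 1) (Set.Ici_subset_Ici.2 hab.le)
    (measurableSet_Ici (a := b))
  rw [hd] at h
  have hpos : 0 < (gaussianReal 0 1).real (Set.Ico a b) := by
    refine ENNReal.toReal_pos (fun h0 => ?_) (measure_ne_top _ _)
    have := gaussianReal_absolutelyContinuous' 0 one_ne_zero h0
    simp at this
    linarith
  rw [h] at hpos
  exact sub_pos.1 hpos

/-- The probability in question, compared with the Gaussian tail, at a threshold `a / √(n + a²)`. -/
lemma abs_stdGaussian_real_ratio_sub_le {n : ℕ} (hn : n ≠ 0) {a M : ℝ} (ha : |a| ≤ M) :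
    |(_root_.stdGaussian (n + 1)).real {z | a / √(n + a ^ 2) ≤ z 0 / √(∑ i, z i ^ 2)}
        - gaussianTail a|
      ≤ (M ^ 2 + M) * Var[fun x : ℝ => x ^ 2; gaussianReal 0 1] / n := by
  rw [stdGaussian_succ_real_div_sqrt hn, mul_div_assoc]
  refine (abs_stdGaussian_succ_real_sub_gaussianTail_le hn a).trans ?_
  have h : 0 ≤ Var[fun x : ℝ => x ^ 2; gaussianReal 0 1] / n :=
    div_nonneg (variance_nonneg _ _) (Nat.cast_nonneg n)
  rw [← sq_abs]
  gcongr

lemma stdGaussian_real_ratio_antitone (n : ℕ) :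
    Antitone fun t : ℝ =>
      (_root_.stdGaussian (n + 1)).real {z | t ≤ z 0 / √(∑ i, z i ^ 2)} := fun _ _ h =>
  measureReal_mono fun _ hz => h.trans hz

lemma exists_abs_mul_sqrt_sub_le (tp : ℝ) :
    ∃ C : ℝ, ∃ N : ℕ, ∀ n : ℕ, N ≤ n → ∀ t : ℝ,
      (_root_.stdGaussian (n + 1)).real {z | t ≤ z 0 / √(∑ i, z i ^ 2)} = gaussianTail tp →
      |t * √(n + 1) - tp| ≤ C / n := by
  set M := |tp| + 1 with hM
  set K := (M ^ 2 + M) * Var[fun x : ℝ => x ^ 2; gaussianReal 0 1] with hK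
  set m := gaussianPDFReal 0 1 tp with hm
  have hm0 : 0 < m := gaussianPDFReal_pos _ _ _ one_ne_zero
  have hK0 : 0 ≤ K := mul_nonneg (by positivity) (variance_nonneg _ _)
  set c := (K + 1) / m with hc
  have hc0 : 0 < c := by positivity
  have hmc : m * c = K + 1 := by rw [hc]; field_simp
  refine ⟨c + M * (1 + M ^ 2), ⌈c⌉₊ + ⌈c ^ 2⌉₊ + 1, fun n hn t ht => ?_⟩
  have hn' : (⌈c⌉₊ : ℝ) + ⌈c ^ 2⌉₊ + 1 ≤ n := by exact_mod_cast hn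
  have hcn : c < n := by
    linarith [Nat.le_ceil c, Nat.cast_nonneg (α := ℝ) ⌈c ^ 2⌉₊]
  have hc2n : c ^ 2 < n := by
    linarith [Nat.le_ceil (c ^ 2), Nat.cast_nonneg (α := ℝ) ⌈c⌉₊]
  have hn0 : (0 : ℝ) < n := hc0.trans hcn
  have hn1 : n ≠ 0 := by omega
  have hδ1 : c / n ≤ 1 := (div_le_one hn0).2 hcn.le
  have hδ0 : 0 < c / n := by positivity
  have hgap : K / n + (c / n) ^ 2 < m * (c / n) := by
    have h : m * (c / n) - K / n - (c / n) ^ 2 = (n - c ^ 2) / n ^ 2 := by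
      field_simp
      linear_combination (n : ℝ) * hmc
    have : 0 < (n - c ^ 2) / (n : ℝ) ^ 2 := div_pos (by linarith) (by positivity)
    linarith
  have hsq : 0 < √((n : ℝ) + 1) := Real.sqrt_pos.2 (by positivity)
  have hupper : |tp + c / n| ≤ M :=
    (abs_add_le _ _).trans (by rw [abs_of_pos hδ0]; linarith)
  have hlower : |tp - c / n| ≤ M :=
    (abs_sub _ _).trans (by rw [abs_of_pos hδ0]; linarith)
  have hu1 := abs_le.1 (abs_stdGaussian_real_ratio_sub_le hn1 hupper)
  have hl1 := abs_le.1 (abs_stdGaussian_real_ratio_sub_le hn1 hlower)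
  have hu2 := abs_le.1 (abs_gaussianTail_sub_add_le tp (tp + c / n))
  have hl2 := abs_le.1 (abs_gaussianTail_sub_add_le tp (tp - c / n))
  have hu3 := abs_le.1 (abs_div_sqrt_mul_sqrt_sub_le hn0 hupper)
  have hl3 := abs_le.1 (abs_div_sqrt_mul_sqrt_sub_le hn0 hlower)
  rw [← hK] at hu1 hl1
  rw [← hm] at hu2 hl2
  have htu : t < (tp + c / n) / √(n + (tp + c / n) ^ 2) := by
    by_contra! h
    have := stdGaussian_real_ratio_antitone n h
    simp only [ht] at this
    nlinarith [hu1.2, hu2.2]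
  have htl : (tp - c / n) / √(n + (tp - c / n) ^ 2) < t := by
    by_contra! h
    have := stdGaussian_real_ratio_antitone n h
    simp only [ht] at this
    nlinarith [hl1.1, hl2.1]
  have htu2 := mul_lt_mul_of_pos_right htu hsq
  have htl2 := mul_lt_mul_of_pos_right htl hsq
  rw [add_div, abs_le]
  constructor <;> linarith [hu3.2, hl3.1]

/-- Let `p ∈ (0, 1/2]` be fixed, and for each dimension `d` let `t_{p,d}` be defined by
`P(z₁/‖z‖ ≥ t_{p,d}) = p` for `z` standard Gaussian in `ℝ^d`; let `t_p = Φ⁻¹(1−p)`,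
i.e. `P(Z ≥ t_p) = p` for a standard normal `Z`.  Then there is a constant `C_p` such
that for all sufficiently large `d`, `|t_{p,d}·√d − t_p| ≤ C_p/d`. -/
theorem threshold_convergence_rate (p : ℝ) (hp0 : 0 < p) (hp : p ≤ 1 / 2) :
    ∃ C : ℝ, ∃ D : ℕ, ∀ d : ℕ, ∀ _hd : D + 1 ≤ d, ∀ t tp : ℝ,
      (stdGaussian d) {z | t ≤ z ⟨0, by omega⟩ / Real.sqrt (∑ i, z i ^ 2)}
          = ENNReal.ofReal p →
      (gaussianReal 0 1) (Set.Ici tp) = ENNReal.ofReal p →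
      |t * Real.sqrt d - tp| ≤ C / d := by
  by_cases hex : ∃ tp, (gaussianReal 0 1) (Set.Ici tp) = ENNReal.ofReal p
  · obtain ⟨tp, htp⟩ := hex
    obtain ⟨C, N, hC⟩ := exists_abs_mul_sqrt_sub_le tp
    refine ⟨2 * |C|, N + 1, fun d hd t tp' ht htp' => ?_⟩
    obtain ⟨n, rfl⟩ : ∃ n, d = n + 1 := ⟨d - 1, by omega⟩
    obtain rfl : tp' = tp := gaussianTail_injective
      (by simp only [gaussianTail, measureReal_def, htp, htp'])
    have h := hC n (by omega) t
      (by simp only [gaussianTail, measureReal_def, htp]; exact congrArg ENNReal.toReal ht)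
    have hn : (1 : ℝ) ≤ n := by exact_mod_cast (by omega : 1 ≤ n)
    push_cast
    refine h.trans ?_
    rw [div_le_div_iff₀ (by positivity) (by positivity)]
    nlinarith [le_abs_self C, abs_nonneg C]
  · exact ⟨0, 0, fun d _ t tp _ htp => (hex ⟨tp, htp⟩).elim⟩
end
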